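/- For every real ε with 0 < ε < 1/2 there exists A such that for all integers a ≥ A and all integers b with a < b ≤ a + (1/2 − ε)·log a, one has v_{a,b} ≥ v_{a,b-1}. Equivalently, with b(a) the least b > a such that v_{a,b} < v_{a,b-1}, liminf_{a→∞} (b(a) − a)/log a ≥ 1/2. -/

import Mathlib

open Finset Filter

/-- `Lab r a b` is the least common multiple of those `i ∈ {a,…,b}` with `r i ≠ 0`
(equal to `1` if there are none). -/
def Lab (r : ℕ → ℤ) (a b : ℕ) : ℕ :=
  ((Finset.Icc a b).filter fun i => r i ≠ 0).lcm id

/-- `Xab r a b = L_{a,b} · Σ_{i=a}^b r_i / i`, as an integer. -/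
def Xab (r : ℕ → ℤ) (a b : ℕ) : ℤ :=
  ∑ i ∈ Finset.Icc a b, r i * ((Lab r a b / i : ℕ) : ℤ)

def gab (r : ℕ → ℤ) (a b : ℕ) : ℕ :=
  Int.gcd (Xab r a b) (Lab r a b)

/-- `vab r a b` is the denominator of `Σ_{i=a}^b r_i / i` in lowest terms. -/
def vab (r : ℕ → ℤ) (a b : ℕ) : ℕ :=
  Lab r a b / gab r a b

/-- `bfun r a` is the least `b > a` with `v_{a,b} < v_{a,b-1}`. -/
noncomputable def bfun (r : ℕ → ℤ) (a : ℕ) : ℕ :=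
  sInf {b : ℕ | a < b ∧ vab r a b < vab r a (b - 1)}

section PrimesInProgressions

open Topology MeasureTheory

noncomputable def fejer (u : ℝ) : ℝ := Real.sinc (u / 2) ^ 2

lemma fejer_nonneg (u : ℝ) : 0 ≤ fejer u := sq_nonneg _

lemma fejer_le_one (u : ℝ) : fejer u ≤ 1 := by
  unfold fejer
  exact (sq_le_one_iff_abs_le_one _).2 (Real.abs_sinc_le_one _)

lemma continuous_fejer : Continuous fejer := by
  unfold fejer; fun_prop

lemma fejer_mul_sq (u : ℝ) : fejer u * u ^ 2 = 2 * (1 - Real.cos u) := by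
  unfold fejer
  have h : Real.cos u = 1 - 2 * Real.sin (u / 2) ^ 2 := by
    rw [← Real.cos_sq_add_sin_sq (u / 2)]
    have := Real.cos_two_mul (u / 2)
    rw [show 2 * (u / 2) = u by ring] at this
    rw [this]; nlinarith [Real.cos_sq_add_sin_sq (u / 2)]
  rw [h]
  by_cases hu : u = 0
  · simp [hu]
  · rw [Real.sinc_of_ne_zero (by simpa using hu)]
    field_simp
    ring

lemma fejer_le (u : ℝ) : fejer u ≤ 5 / (1 + u ^ 2) := by
  rw [le_div_iff₀ (by positivity)]
  nlinarith [fejer_mul_sq u, fejer_le_one u, Real.neg_one_le_cos u]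

lemma integrable_fejer : MeasureTheory.Integrable fejer := by
  refine MeasureTheory.Integrable.mono' (g := fun u => 5 * (1 + u ^ 2)⁻¹)
    (integrable_inv_one_add_sq.const_mul 5) continuous_fejer.aestronglyMeasurable ?_
  filter_upwards with u
  rw [Real.norm_of_nonneg (fejer_nonneg u)]
  simpa [div_eq_mul_inv] using fejer_le u

lemma integral_fejer_pos : 0 < ∫ u, fejer u := by
  refine MeasureTheory.integral_pos_of_integrable_nonneg_nonzero (x := 0) continuous_fejer
    integrable_fejer fejer_nonneg ?_
  simp [fejer]

/-- The Fejér kernel is the Fourier transform of the triangle function. -/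
lemma integral_triangle_exp (u : ℝ) :
    ∫ t in (-1 : ℝ)..1, ((1 - |t| : ℝ) : ℂ) * Complex.exp (-(t * u * Complex.I)) = fejer u := by
  have hc : Continuous fun t : ℝ => ((1 - |t| : ℝ) : ℂ) * Complex.exp (-(t * u * Complex.I)) := by
    fun_prop
  rw [← intervalIntegral.integral_add_adjacent_intervals (b := 0)
    (hc.intervalIntegrable _ _) (hc.intervalIntegrable _ _)]
  have h1 := intervalIntegral.integral_comp_neg (a := 0) (b := 1)
    (fun t : ℝ => ((1 - |t| : ℝ) : ℂ) * Complex.exp (-(t * u * Complex.I)))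
  simp only [neg_zero] at h1
  rw [← h1, ← intervalIntegral.integral_add
    ((by fun_prop : Continuous _).intervalIntegrable _ _) (hc.intervalIntegrable _ _)]
  have h2 : ∫ t in (0 : ℝ)..1, 
      (((1 - |-t| : ℝ) : ℂ) * Complex.exp (-((-t : ℝ) * u * Complex.I)) +
      ((1 - |t| : ℝ) : ℂ) * Complex.exp (-(t * u * Complex.I))) =
      ∫ t in (0 : ℝ)..1, ((2 * (1 - t) * Real.cos (t * u) : ℝ) : ℂ) := by
    refine intervalIntegral.integral_congr fun t ht => ?_
    rw [Set.uIcc_of_le zero_le_one] at ht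
    simp only [abs_neg, abs_of_nonneg ht.1]
    have := Complex.two_cos (t * u)
    push_cast
    rw [mul_right_comm 2 (1 - (t : ℂ)), this]
    ring_nf
  rw [h2, intervalIntegral.integral_ofReal]
  congr 1
  by_cases hu : u = 0
  · subst hu
    have : ∫ t in (0 : ℝ)..1, (1 - t) = 1 / 2 := by
      rw [intervalIntegral.integral_sub (by simp) (by simp)]
      norm_num
    simp [fejer, this]
  · have hu2 : fejer u = 2 * (1 - Real.cos u) / u ^ 2 := by
      rw [eq_div_iff (by positivity), fejer_mul_sq]
    have := intervalIntegral.integral_eq_sub_of_hasDerivAt (a := 0) (b := 1)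
      (f := fun t => 2 * ((1 - t) * Real.sin (t * u) / u - Real.cos (t * u) / u ^ 2))
      (f' := fun t => 2 * (1 - t) * Real.cos (t * u)) (fun t _ => by
        have h1 : HasDerivAt (fun t => t * u) u t := by simpa using (hasDerivAt_id t).mul_const u
        have h2 := h1.sin
        have h3 := h1.cos
        have h4 : HasDerivAt (fun t : ℝ => 1 - t) (-1) t := by simpa using (hasDerivAt_id t).const_sub 1
        refine ((((h4.mul h2).div_const u).sub (h3.div_const (u ^ 2))).const_mul 2).congr_deriv ?_
        field_simp
        ring) ((by fun_prop : Continuous _).intervalIntegrable _ _)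
    rw [this, hu2]
    simp
    field_simp
    ring

/-- Smoothed sum of a Dirichlet series along a vertical segment. -/
lemma hasSum_fejer_of_LSeriesSummable {f : ℕ → ℝ} (hf : ∀ n, 0 ≤ f n) (hf0 : f 0 = 0)
    {δ : ℝ} (hs : LSeriesSummable (fun n => (f n : ℂ)) (1 + δ : ℝ)) (l y : ℝ) :
    HasSum (fun n : ℕ => ((f n * (n : ℝ) ^ (-(1 + δ)) * fejer (l * (Real.log n - y)) : ℝ) : ℂ))
      (∫ t in (-1 : ℝ)..1, ((1 - |t| : ℝ) : ℂ) * Complex.exp (t * (l * y) * Complex.I) *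
        LSeries (fun n => (f n : ℂ)) (1 + δ + t * l * Complex.I)) := by
  have hterm : ∀ (n : ℕ) (t : ℝ), LSeries.term (fun n => (f n : ℂ)) (1 + δ + t * l * Complex.I) n
      = ((f n * (n : ℝ) ^ (-(1 + δ)) : ℝ) : ℂ) * Complex.exp (-(t * (l * Real.log n) * Complex.I)) := by
    intro n t
    rcases eq_or_ne n 0 with rfl | hn
    · simp [hf0]
    · have he : (n : ℂ) ^ (-(t * l * Complex.I)) =
          Complex.exp (-(t * (l * Real.log n) * Complex.I)) := by
        rw [Complex.cpow_def_of_ne_zero (by exact_mod_cast hn), Complex.natCast_log]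
        congr 1; ring
      rw [LSeries.term_of_ne_zero hn, Complex.ofReal_mul, Complex.ofReal_cpow (by positivity),
        Complex.ofReal_natCast, div_eq_mul_inv, ← Complex.cpow_neg,
        show -(1 + (δ : ℂ) + t * l * Complex.I) = ((-(1 + δ) : ℝ) : ℂ) + -(t * l * Complex.I) by
          push_cast; ring,
        Complex.cpow_add _ _ (by exact_mod_cast hn), he]
      ring
  have hbd : Summable fun n : ℕ => f n * (n : ℝ) ^ (-(1 + δ)) := by
    have := hs.norm
    refine this.congr fun n => ?_
    have := hterm n 0
    simp only [Complex.ofReal_zero, zero_mul, add_zero, neg_zero, Complex.exp_zero, mul_one] at this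
    rw [show ((1 + δ : ℝ) : ℂ) = 1 + δ by push_cast; rfl, this, Complex.norm_real,
      Real.norm_of_nonneg (mul_nonneg (hf n) (by positivity))]
  have hnorm : ∀ (n : ℕ) (t : ℝ), ‖LSeries.term (fun n => (f n : ℂ)) (1 + δ + t * l * Complex.I) n‖
      = f n * (n : ℝ) ^ (-(1 + δ)) := by
    intro n t
    rw [hterm, norm_mul, Complex.norm_real, Real.norm_of_nonneg (mul_nonneg (hf n) (by positivity)),
      show -((t : ℂ) * (l * Real.log n) * Complex.I) = ((-(t * (l * Real.log n)) : ℝ) : ℂ) * Complex.I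
        by push_cast; ring, Complex.norm_exp_ofReal_mul_I, mul_one]
  have key := intervalIntegral.hasSum_integral_of_dominated_convergence (μ := volume)
    (a := -1) (b := 1)
    (F := fun (n : ℕ) (t : ℝ) => ((1 - |t| : ℝ) : ℂ) * Complex.exp (t * (l * y) * Complex.I) *
        LSeries.term (fun n => (f n : ℂ)) (1 + δ + t * l * Complex.I) n)
    (f := fun t => ((1 - |t| : ℝ) : ℂ) * Complex.exp (t * (l * y) * Complex.I) *
        LSeries (fun n => (f n : ℂ)) (1 + δ + t * l * Complex.I))
    (fun n _ => f n * (n : ℝ) ^ (-(1 + δ))) (fun n => by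
      simp only [hterm]
      exact (by fun_prop : Continuous _).aestronglyMeasurable) (fun n => by
      filter_upwards with t ht
      rw [Set.uIoc_of_le (by norm_num)] at ht
      have h1 : |t| ≤ 1 := abs_le.2 ⟨ht.1.le, ht.2⟩
      rw [norm_mul, norm_mul, hnorm, Complex.norm_real, Real.norm_of_nonneg (by linarith),
        show (t : ℂ) * (l * y) * Complex.I = ((t * (l * y) : ℝ) : ℂ) * Complex.I
        by push_cast; ring, Complex.norm_exp_ofReal_mul_I, mul_one]
      have := mul_nonneg (hf n) (by positivity : 0 ≤ (n : ℝ) ^ (-(1 + δ)))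
      nlinarith [abs_nonneg t])
    (by filter_upwards with t _ using hbd) (by simp) (by
      filter_upwards with t _
      refine HasSum.mul_left _ ?_
      exact Summable.hasSum (Summable.of_norm (by simpa only [hnorm] using hbd)))
  refine key.congr_fun ?_
  intro n
  rw [Complex.ofReal_mul, ← integral_triangle_exp, ← intervalIntegral.integral_const_mul]
  refine intervalIntegral.integral_congr fun t _ => ?_
  simp only [hterm]
  rw [mul_left_comm, mul_assoc (((1 - |t| : ℝ) : ℂ)), mul_left_comm (Complex.exp _), ← Complex.exp_add]
  congr 3
  push_cast; ring_nf

lemma integral_triangle_div {δ : ℝ} (hδ : 0 < δ) (l y : ℝ) :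
    ∫ t in (-1 : ℝ)..1, ((1 - |t| : ℝ) : ℂ) * Complex.exp (t * (l * y) * Complex.I) *
      (1 / (δ + t * l * Complex.I)) =
    ((∫ u in Set.Ioi (0 : ℝ), Real.exp (-δ * u) * fejer (l * (u - y)) : ℝ) : ℂ) := by
  have h1 : ∀ t : ℝ, 1 / ((δ : ℂ) + t * l * Complex.I) =
      ∫ u in Set.Ioi (0 : ℝ), Complex.exp (-(δ + t * l * Complex.I) * u) := by
    intro t
    rw [integral_exp_mul_complex_Ioi (by simpa using hδ)]
    rw [Complex.ofReal_zero, mul_zero, Complex.exp_zero, neg_div_neg_eq]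
  simp_rw [h1, ← integral_const_mul]
  have hintF : Integrable (Function.uncurry fun (t u : ℝ) =>
      ((1 - |t| : ℝ) : ℂ) * Complex.exp (t * (l * y) * Complex.I) *
      Complex.exp (-(δ + t * l * Complex.I) * u))
      ((volume.restrict (Set.uIoc (-1) 1)).prod (volume.restrict (Set.Ioi 0))) := by
    have : Integrable (fun p : ℝ × ℝ => (1 : ℝ) * Real.exp (-δ * p.2))
        ((volume.restrict (Set.uIoc (-1) 1)).prod (volume.restrict (Set.Ioi 0))) :=
      Integrable.mul_prod (f := fun _ : ℝ => (1 : ℝ)) (μ := volume.restrict (Set.uIoc (-1) 1))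
        (by rw [Set.uIoc_of_le (by norm_num)]; exact integrable_const _)
        (exp_neg_integrableOn_Ioi 0 hδ)
    refine this.mono' (by unfold Function.uncurry; fun_prop) ?_
    rw [Measure.prod_restrict]
    refine (ae_restrict_iff' (measurableSet_uIoc.prod measurableSet_Ioi)).2 ?_
    filter_upwards with p hp
    have ht := hp.1
    rw [Set.uIoc_of_le (by norm_num)] at ht
    have h1 : |p.1| ≤ 1 := abs_le.2 ⟨ht.1.le, ht.2⟩
    simp only [Function.uncurry]
    rw [norm_mul, norm_mul, Complex.norm_real, Real.norm_of_nonneg (by linarith),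
        show (p.1 : ℂ) * (l * y) * Complex.I = ((p.1 * (l * y) : ℝ) : ℂ) * Complex.I
        by push_cast; ring, Complex.norm_exp_ofReal_mul_I, mul_one, Complex.norm_exp]
    have hre : (-((δ : ℂ) + p.1 * l * Complex.I) * p.2).re = -δ * p.2 := by simp
    rw [hre]
    nlinarith [abs_nonneg p.1, Real.exp_pos (-δ * p.2)]
  rw [intervalIntegral_integral_swap hintF, ← integral_complex_ofReal]
  refine integral_congr_ae ?_
  filter_upwards with u
  rw [Complex.ofReal_mul, ← integral_triangle_exp, ← intervalIntegral.integral_const_mul]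
  refine intervalIntegral.integral_congr fun t _ => ?_
  rw [mul_assoc, ← Complex.exp_add, Complex.ofReal_exp, mul_left_comm (Complex.exp (-δ * u : ℝ)),
    ← Complex.exp_add]
  congr 2
  push_cast; ring_nf

/-- The hypotheses of the Wiener–Ikehara theorem for the Dirichlet series of `f`, with residue `A`
at `1`; `G` is the continuous extension of the difference to the closed half plane. -/
structure WienerIkehara (f : ℕ → ℝ) (A : ℝ) (G : ℂ → ℂ) : Prop where
  nonneg : ∀ n, 0 ≤ f n
  zero : f 0 = 0
  summable : ∀ s : ℂ, 1 < s.re → LSeriesSummable (fun n => (f n : ℂ)) s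
  cont : ContinuousOn G {s | 1 ≤ s.re}
  eq : Set.EqOn G (fun s => LSeries (fun n => (f n : ℂ)) s - A / (s - 1)) {s | 1 < s.re}

lemma hasSum_of_tendsto_hasSum {ι : Type*} {a : ι → ℝ} {b : ℝ → ι → ℝ} {S : ℝ → ℝ} {s : ℝ}
    {l : Filter ℝ} [l.NeBot]
    (hb0 : ∀ᶠ δ in l, ∀ n, 0 ≤ b δ n) (hb : ∀ᶠ δ in l, ∀ n, b δ n ≤ a n)
    (hlim : ∀ n, Tendsto (fun δ => b δ n) l (𝓝 (a n)))
    (hS : ∀ᶠ δ in l, HasSum (b δ) (S δ)) (hs : Tendsto S l (𝓝 s)) : HasSum a s := by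
  have ha : ∀ n, 0 ≤ a n := fun n => by
    obtain ⟨δ, h1, h2⟩ := (hb0.and hb).exists
    exact (h1 n).trans (h2 n)
  have hfin : ∀ u : Finset ι, ∑ n ∈ u, a n ≤ s := fun u => by
    refine le_of_tendsto_of_tendsto (tendsto_finsetSum u fun n _ => hlim n) hs ?_
    filter_upwards [hb0, hS] with δ h1 h2
    exact sum_le_hasSum u (fun n _ => h1 n) h2
  have hsum : Summable a := summable_of_sum_le ha hfin
  have h1 : ∑' n, a n ≤ s := Real.tsum_le_of_sum_le ha hfin
  have h2 : s ≤ ∑' n, a n := by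
    refine le_of_tendsto hs ?_
    filter_upwards [hb, hS] with δ h1 h2
    exact hasSum_le h1 h2 hsum.hasSum
  rw [← le_antisymm h1 h2]
  exact hsum.hasSum

namespace WienerIkehara

variable {f : ℕ → ℝ} {A : ℝ} {G : ℂ → ℂ}

lemma hasSum_fejer_of_pos (h : WienerIkehara f A G) {δ : ℝ} (hδ : 0 < δ) {l : ℝ} (y : ℝ) :
    HasSum (fun n : ℕ => f n * (n : ℝ) ^ (-(1 + δ)) * fejer (l * (Real.log n - y)))
      (A * (∫ u in Set.Ioi (0 : ℝ), Real.exp (-δ * u) * fejer (l * (u - y))) +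
        (∫ t in (-1 : ℝ)..1, ((1 - |t| : ℝ) : ℂ) * Complex.exp (t * (l * y) * Complex.I) *
          G (1 + (max δ 0 : ℝ) + t * l * Complex.I)).re) := by
  have key := hasSum_fejer_of_LSeriesSummable h.nonneg h.zero
    (h.summable (1 + δ : ℝ) (by rw [Complex.ofReal_re]; linarith)) l y
  have hre : ∀ t : ℝ, (1 + δ + t * l * Complex.I : ℂ).re = 1 + δ := by intro t; simp
  have hne : ∀ t : ℝ, (δ + t * l * Complex.I : ℂ) ≠ 0 := fun t h0 => by
    have := congrArg Complex.re h0
    simp at this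
    exact hδ.ne' this
  have hG : Continuous fun t : ℝ => G (1 + δ + t * l * Complex.I) := by
    refine h.cont.comp_continuous (by fun_prop) fun t => ?_
    simp only [Set.mem_ofPred_eq, hre]; linarith
  have hsplit : (∫ t in (-1 : ℝ)..1, ((1 - |t| : ℝ) : ℂ) * Complex.exp (t * (l * y) * Complex.I) *
        LSeries (fun n => (f n : ℂ)) (1 + δ + t * l * Complex.I)) =
      A * (∫ t in (-1 : ℝ)..1, ((1 - |t| : ℝ) : ℂ) * Complex.exp (t * (l * y) * Complex.I) *
        (1 / (δ + t * l * Complex.I))) +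
      ∫ t in (-1 : ℝ)..1, ((1 - |t| : ℝ) : ℂ) * Complex.exp (t * (l * y) * Complex.I) *
        G (1 + δ + t * l * Complex.I) := by
    rw [← intervalIntegral.integral_const_mul, ← intervalIntegral.integral_add]
    · refine intervalIntegral.integral_congr fun t _ => ?_
      have := h.eq (x := 1 + δ + t * l * Complex.I) (by
        simp only [Set.mem_ofPred_eq, hre]; linarith)
      simp only at this ⊢
      rw [this]
      have := hne t
      rw [show (1 + δ + t * l * Complex.I - 1 : ℂ) = δ + t * l * Complex.I by ring]
      field_simp
      ring
    · refine Continuous.intervalIntegrable ?_ _ _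
      have : Continuous fun t : ℝ => 1 / (δ + t * l * Complex.I : ℂ) :=
        continuous_const.div (by fun_prop) hne
      fun_prop
    · exact Continuous.intervalIntegrable (Continuous.mul (by fun_prop) hG) _ _
  rw [hsplit, integral_triangle_div hδ] at key
  have := Complex.hasSum_re key
  simp only [Complex.ofReal_re, Complex.add_re, Complex.re_ofReal_mul] at this
  rw [max_eq_left hδ.le]
  exact this

lemma hasSum_fejer (h : WienerIkehara f A G) {l : ℝ} (hl : 0 < l) (y : ℝ) :
    HasSum (fun n : ℕ => f n / n * fejer (l * (Real.log n - y)))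
      (A * (∫ u in Set.Ioi (0 : ℝ), fejer (l * (u - y))) +
        (∫ t in (-1 : ℝ)..1, ((1 - |t| : ℝ) : ℂ) * Complex.exp (t * (l * y) * Complex.I) *
          G (1 + t * l * Complex.I)).re) := by
  have hI : Integrable (fun u => fejer (l * (u - y))) :=
    (integrable_fejer.comp_mul_left' hl.ne').comp_sub_right y
  have hpos : ∀ᶠ δ : ℝ in 𝓝[>] 0, 0 < δ := self_mem_nhdsWithin
  refine hasSum_of_tendsto_hasSum (l := 𝓝[>] (0 : ℝ))
    (b := fun δ n => f n * (n : ℝ) ^ (-(1 + δ)) * fejer (l * (Real.log n - y)))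
    (S := fun δ => A * (∫ u in Set.Ioi (0 : ℝ), Real.exp (-δ * u) * fejer (l * (u - y))) +
        (∫ t in (-1 : ℝ)..1, ((1 - |t| : ℝ) : ℂ) * Complex.exp (t * (l * y) * Complex.I) *
          G (1 + (max δ 0 : ℝ) + t * l * Complex.I)).re) ?_ ?_ ?_ ?_ ?_
  · filter_upwards with δ n
    have := h.nonneg n
    have := fejer_nonneg (l * (Real.log n - y))
    positivity
  · filter_upwards [hpos] with δ hδ n
    refine mul_le_mul_of_nonneg_right ?_ (fejer_nonneg _)
    rw [div_eq_mul_inv]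
    rcases eq_or_ne n 0 with rfl | hn
    · simp [h.zero]
    · refine mul_le_mul_of_nonneg_left ?_ (h.nonneg n)
      rw [← Real.rpow_neg_one]
      exact Real.rpow_le_rpow_of_exponent_le (by exact_mod_cast Nat.one_le_iff_ne_zero.2 hn)
        (by linarith)
  · intro n
    rcases eq_or_ne n 0 with rfl | hn
    · simp [h.zero]
    · have : Continuous fun δ : ℝ => f n * (n : ℝ) ^ (-(1 + δ)) * fejer (l * (Real.log n - y)) := by
        have : (n : ℝ) ≠ 0 := by exact_mod_cast hn
        have : Continuous fun δ : ℝ => (n : ℝ) ^ (-(1 + δ)) :=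
          continuous_const.rpow (by fun_prop) fun _ => Or.inl this
        fun_prop
      have := (this.tendsto 0).mono_left (nhdsWithin_le_nhds (s := Set.Ioi 0))
      simpa [Real.rpow_neg_one, div_eq_mul_inv] using this
  · filter_upwards [hpos] with δ hδ
    exact h.hasSum_fejer_of_pos hδ y
  · refine Tendsto.add (Tendsto.const_mul A ?_) ?_
    · refine tendsto_integral_filter_of_dominated_convergence (fun u => fejer (l * (u - y))) ?_ ?_
        hI.integrableOn ?_
      · filter_upwards with δ
        have := continuous_fejer
        exact (by fun_prop : Continuous _).aestronglyMeasurable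
      · filter_upwards [hpos] with δ hδ
        refine (ae_restrict_iff' measurableSet_Ioi).2 ?_
        filter_upwards with u hu
        have hf := fejer_nonneg (l * (u - y))
        rw [Real.norm_of_nonneg (by positivity)]
        refine mul_le_of_le_one_left hf (Real.exp_le_one_iff.2 ?_)
        have := mul_pos hδ hu
        linarith
      · filter_upwards with u
        have : Continuous fun δ : ℝ => Real.exp (-δ * u) * fejer (l * (u - y)) := by fun_prop
        have := (this.tendsto 0).mono_left (nhdsWithin_le_nhds (s := Set.Ioi 0))
        simpa using this
    · have hG : Continuous fun p : ℝ × ℝ => G (1 + (max p.1 0 : ℝ) + p.2 * l * Complex.I) := by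
        refine h.cont.comp_continuous (by fun_prop) fun p => ?_
        simp
      have : Continuous fun δ : ℝ => ∫ t in (-1 : ℝ)..1, ((1 - |t| : ℝ) : ℂ) *
          Complex.exp (t * (l * y) * Complex.I) * G (1 + (max δ 0 : ℝ) + t * l * Complex.I) := by
        refine intervalIntegral.continuous_parametric_intervalIntegral_of_continuous' ?_ _ _
        have : Continuous (Function.uncurry fun δ t : ℝ => ((1 - |t| : ℝ) : ℂ) *
          Complex.exp (t * (l * y) * Complex.I) * G (1 + (max δ 0 : ℝ) + t * l * Complex.I)) := by
          exact Continuous.mul (by fun_prop) hG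
        exact this
      have := (Complex.continuous_re.comp this).tendsto 0 |>.mono_left
        (nhdsWithin_le_nhds (s := Set.Ioi 0))
      simpa [Function.comp_def] using this

lemma tendsto_tsum_fejer (h : WienerIkehara f A G) {l : ℝ} (hl : 0 < l) :
    Tendsto (fun y => ∑' n : ℕ, f n / n * fejer (l * (Real.log n - y))) atTop
      (𝓝 (A * ((∫ u, fejer u) / l))) := by
  have heq := fun y => (h.hasSum_fejer hl y).tsum_eq
  simp_rw [heq]
  rw [← add_zero (A * _)]
  refine Tendsto.add (Tendsto.const_mul A ?_) ?_
  · have h1 : ∀ y, ∫ u in Set.Ioi (0 : ℝ), fejer (l * (u - y)) =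
        ∫ u in Set.Ioi (-y), fejer (l * u) := fun y => by
      rw [← integral_indicator measurableSet_Ioi, ← integral_indicator measurableSet_Ioi,
        ← integral_add_right_eq_self _ y]
      refine integral_congr_ae (Eventually.of_forall fun u => ?_)
      simp [Set.indicator, neg_lt_iff_pos_add]
    simp_rw [h1]
    have h2 : (∫ u, fejer u) / l = ∫ u, fejer (l * u) := by
      rw [Measure.integral_comp_mul_left, abs_of_pos (inv_pos.2 hl), smul_eq_mul]
      ring
    rw [h2]
    exact (aecover_Ioi tendsto_neg_atTop_atBot).integral_tendsto_of_countably_generated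
      (integrable_fejer.comp_mul_left' hl.ne')
  · have hRL := Real.tendsto_integral_exp_smul_cocompact
      (fun t : ℝ => Set.indicator (Set.Ioc (-1 : ℝ) 1)
        (fun t : ℝ => ((1 - |t| : ℝ) : ℂ) * G (1 + t * l * Complex.I)) t)
    have hlim : Tendsto (fun y : ℝ => -(l * y / (2 * Real.pi))) atTop (cocompact ℝ) := by
      refine Tendsto.mono_right ?_ atBot_le_cocompact
      refine tendsto_neg_atTop_atBot.comp ?_
      exact (tendsto_id.const_mul_atTop hl).atTop_div_const (by positivity)
    have := (Complex.continuous_re.tendsto 0).comp (hRL.comp hlim)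
    refine this.congr fun y => ?_
    simp only [Function.comp]
    congr 1
    rw [intervalIntegral.integral_of_le (by norm_num), ← integral_indicator measurableSet_Ioc]
    refine integral_congr_ae (Eventually.of_forall fun t => ?_)
    simp only [Set.indicator]
    split_ifs
    · rw [Circle.smul_def, Real.fourierChar_apply, smul_eq_mul,
        mul_comm (((1 - |t| : ℝ) : ℂ)) (Complex.exp _), ← mul_assoc]
      congr 4
      have := Real.pi_ne_zero
      push_cast
      field_simp
    · simp

end WienerIkehara

lemma fejer_mul_le (L : ℝ) {v : ℝ} (hv : 1 ≤ |v|) :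
    fejer (L * v) * L ^ 2 ≤ (1 + Real.pi) ^ 2 * (fejer v + fejer (v - Real.pi)) := by
  have h1 := fejer_mul_sq v
  have h2 := fejer_mul_sq (v - Real.pi)
  rw [Real.cos_sub_pi] at h2
  have h3 := fejer_mul_sq (L * v)
  have hv2 : 0 < v ^ 2 := by
    have : 0 < |v| := by linarith
    rw [← sq_abs]; positivity
  have hle : (v - Real.pi) ^ 2 ≤ (1 + Real.pi) ^ 2 * v ^ 2 := by
    rw [← mul_pow, ← sq_abs (v - Real.pi), ← sq_abs ((1 + Real.pi) * v)]
    refine pow_le_pow_left₀ (abs_nonneg _) ?_ 2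
    rw [abs_mul, abs_of_pos (by positivity : (0 : ℝ) < 1 + Real.pi)]
    have := abs_sub v Real.pi
    rw [abs_of_pos Real.pi_pos] at this
    nlinarith [Real.pi_pos]
  have hle1 : v ^ 2 ≤ (1 + Real.pi) ^ 2 * v ^ 2 :=
    le_mul_of_one_le_left hv2.le (one_le_pow₀ (by linarith [Real.pi_pos]))
  have h4 := mul_le_mul_of_nonneg_left hle (fejer_nonneg (v - Real.pi))
  have h5 := mul_le_mul_of_nonneg_left hle1 (fejer_nonneg v)
  refine le_of_mul_le_mul_right ?_ hv2
  nlinarith [Real.neg_one_le_cos (L * v)]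

namespace WienerIkehara

variable {f : ℕ → ℝ} {A : ℝ} {G : ℂ → ℂ}

lemma residue_nonneg (h : WienerIkehara f A G) : 0 ≤ A := by
  have h1 := h.tendsto_tsum_fejer one_pos
  have h2 : 0 ≤ A * ((∫ u, fejer u) / 1) := ge_of_tendsto' h1 fun y =>
    tsum_nonneg fun n => mul_nonneg (div_nonneg (h.nonneg n) (by positivity)) (fejer_nonneg _)
  rw [div_one] at h2
  exact nonneg_of_mul_nonneg_left h2 integral_fejer_pos

/-- Upper bound for the mass of logarithmic intervals. -/
lemma eventually_sum_le (hW : WienerIkehara f A G) {h ε : ℝ} (hh : 0 < h) (hε : 0 < ε) :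
    ∀ᶠ y : ℝ in atTop, ∀ s : Finset ℕ, (∀ n ∈ s, y ≤ Real.log n ∧ Real.log n ≤ y + h) →
      ∑ n ∈ s, f n / n ≤ A * h + ε := by
  set I := ∫ u, fejer u with hI
  have hIpos : 0 < I := integral_fejer_pos
  obtain ⟨η, hη, hηI, hηle⟩ : ∃ η : ℝ, 0 < η ∧ η < I ∧
      (h + 2 * η) * (A * I + η) / (I - η) < A * h + ε := by
    have hc : ContinuousAt (fun η : ℝ => (h + 2 * η) * (A * I + η) / (I - η)) 0 := by
      refine ContinuousAt.div (by fun_prop) (by fun_prop) (by simpa using hIpos.ne')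
    have h1 : (h + 2 * 0) * (A * I + 0) / (I - 0) < A * h + ε := by
      have : (h + 2 * 0) * (A * I + 0) / (I - 0) = A * h := by
        have := hIpos.ne'
        rw [mul_zero, add_zero, add_zero, sub_zero]
        field_simp
      linarith
    have h2 := (hc.eventually_lt continuousAt_const h1).filter_mono
      (nhdsWithin_le_nhds (s := Set.Ioi 0))
    have h3 : ∀ᶠ η : ℝ in 𝓝[>] 0, η ∈ Set.Ioo 0 I := Ioo_mem_nhdsGT hIpos
    obtain ⟨η, h4, h5⟩ := (h2.and h3).exists
    exact ⟨η, h5.1, h5.2, h4⟩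
  obtain ⟨l, hl, hlc⟩ : ∃ l : ℝ, 0 < l ∧ I - η < ∫ u in (-(l * η))..(l * η), fejer u := by
    have ht : Tendsto (fun l : ℝ => l * η) atTop atTop := tendsto_id.atTop_mul_const hη
    have h1 := intervalIntegral_tendsto_integral integrable_fejer
      (tendsto_neg_atTop_atBot.comp ht) ht
    have h2 := h1.eventually_const_lt (show I - η < I by linarith)
    obtain ⟨l, h3, h4⟩ := (h2.and (eventually_gt_atTop 0)).exists
    exact ⟨l, h4, h3⟩
  set c := ∫ u in (-(l * η))..(l * η), fejer u with hc
  have hlim := hW.tendsto_tsum_fejer hl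
  have hev := hlim.eventually_le_const (show A * (I / l) < (A * I + η) / l by
    rw [← mul_div_assoc]; gcongr; linarith)
  obtain ⟨y₀, hy₀⟩ := eventually_atTop.1 hev
  filter_upwards [eventually_ge_atTop (y₀ + η)] with y hy s hs
  have hcont : ∀ n : ℕ, Continuous fun v : ℝ => fejer (l * (Real.log n - v)) := fun n => by
    have := continuous_fejer
    fun_prop
  have hup : ∫ v in (y - η)..(y + h + η), ∑ n ∈ s, f n / n * fejer (l * (Real.log n - v)) ≤
      ∫ v in (y - η)..(y + h + η), (A * I + η) / l := by
    refine intervalIntegral.integral_mono_on (by linarith) ?_ (by simp) fun v hv => ?_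
    · exact Continuous.intervalIntegrable
        (continuous_finsetSum _ fun n _ => (hcont n).const_mul _) _ _
    · refine le_trans ?_ (hy₀ v (by linarith [hv.1]))
      exact (hW.hasSum_fejer hl v).summable.sum_le_tsum s fun n _ =>
        mul_nonneg (div_nonneg (hW.nonneg n) (by positivity)) (fejer_nonneg _)
  rw [intervalIntegral.integral_const, intervalIntegral.integral_finsetSum fun n _ =>
    ((hcont n).const_mul _).intervalIntegrable _ _] at hup
  have hlow : ∀ n ∈ s, f n / n * (c / l) ≤
      ∫ v in (y - η)..(y + h + η), f n / n * fejer (l * (Real.log n - v)) := fun n hn => by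
    rw [intervalIntegral.integral_const_mul]
    refine mul_le_mul_of_nonneg_left ?_ (div_nonneg (hW.nonneg n) (by positivity))
    obtain ⟨h1, h2⟩ := hs n hn
    have h3 : ∫ v in (Real.log n - η)..(Real.log n + η), fejer (l * (Real.log n - v)) = c / l := by
      have h4 : ∀ v : ℝ, fejer (l * (Real.log n - v)) = fejer (l * Real.log n - l * v) := fun v => by
        rw [mul_sub]
      simp_rw [h4]
      rw [intervalIntegral.integral_comp_sub_mul _ hl.ne', smul_eq_mul, hc, div_eq_inv_mul]
      congr 2 <;> ring
    rw [← h3]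
    refine intervalIntegral.integral_mono_interval (by linarith) (by linarith) (by linarith)
      (Eventually.of_forall fun v => fejer_nonneg _) ((hcont n).intervalIntegrable _ _)
  have h1 := (Finset.sum_le_sum hlow).trans hup
  rw [← Finset.sum_mul, smul_eq_mul] at h1
  have hcpos : 0 < c := by linarith
  have h2 : (∑ n ∈ s, f n / n) * c ≤ (h + 2 * η) * (A * I + η) := by
    have := mul_le_mul_of_nonneg_right h1 hl.le
    field_simp at this
    linarith
  have h3 : (∑ n ∈ s, f n / n) ≤ (h + 2 * η) * (A * I + η) / c := by rwa [le_div_iff₀ hcpos]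
  have hA := hW.residue_nonneg
  have h4 : (h + 2 * η) * (A * I + η) / c ≤ (h + 2 * η) * (A * I + η) / (I - η) := by
    refine div_le_div_of_nonneg_left (by positivity) (by linarith) hlc.le
  linarith

/-- Lower bound for the mass of logarithmic intervals. -/
lemma exists_eventually_le_sum (hW : WienerIkehara f A G) (hA : 0 < A) {h : ℝ} (hh : 0 < h) :
    ∃ κ : ℝ, 0 < κ ∧ ∀ᶠ y : ℝ in atTop, ∀ s : Finset ℕ,
      (∀ n : ℕ, n ≠ 0 → |Real.log n - y| ≤ h → n ∈ s) → κ ≤ ∑ n ∈ s, f n / n := by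
  set I := ∫ u, fejer u with hI
  have hIpos : 0 < I := integral_fejer_pos
  set C := (1 + Real.pi) ^ 2 with hC
  have hCpos : 0 < C := by have := Real.pi_pos; positivity
  set L := 4 * C with hL
  have hLpos : 0 < L := by positivity
  have hl : 0 < L / h := by positivity
  have hh' : 0 < h⁻¹ := by positivity
  have l1 := hW.tendsto_tsum_fejer hl
  have l2 := hW.tendsto_tsum_fejer hh'
  have l3 := l2.comp (tendsto_atTop_add_const_right atTop (Real.pi * h) tendsto_id)
  have l4 := l1.sub ((l2.add l3).const_mul (C / L ^ 2))
  have hval : A * (I / (L / h)) - C / L ^ 2 * (A * (I / h⁻¹) + A * (I / h⁻¹)) = A * I * h / (8 * C) := by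
    rw [hL]; field_simp; ring
  rw [hval] at l4
  refine ⟨A * I * h / (16 * C), by positivity, ?_⟩
  have hlt : A * I * h / (16 * C) < A * I * h / (8 * C) := by
    refine div_lt_div_of_pos_left (by positivity) (by positivity) (by linarith)
  filter_upwards [l4.eventually_const_lt hlt] with y hy s hs
  refine hy.le.trans ?_
  simp only [Function.comp, id]
  rw [sub_le_iff_le_add]
  have s1 := (hW.hasSum_fejer hl y).summable
  have s2 := (hW.hasSum_fejer hh' y).summable
  have s3 := (hW.hasSum_fejer hh' (y + Real.pi * h)).summable
  have s4 : HasSum (Set.indicator (s : Set ℕ) fun n => f n / n) (∑ n ∈ s, f n / n) :=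
    (hasSum_subtype_iff_indicator (s := (s : Set ℕ))).1 (s.hasSum _)
  rw [← s2.tsum_add s3, ← tsum_mul_left, ← s4.tsum_eq, ← s4.summable.tsum_add ((s2.add s3).mul_left _)]
  refine s1.tsum_le_tsum (fun n => ?_) (s4.summable.add ((s2.add s3).mul_left _))
  have ha : 0 ≤ f n / n := div_nonneg (hW.nonneg n) (by positivity)
  rw [← mul_add, mul_left_comm]
  have hR : 0 ≤ C / L ^ 2 * (fejer (h⁻¹ * (Real.log n - y)) +
      fejer (h⁻¹ * (Real.log n - (y + Real.pi * h)))) :=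
    mul_nonneg (by positivity) (add_nonneg (fejer_nonneg _) (fejer_nonneg _))
  by_cases hn : n ∈ s
  · rw [Set.indicator_of_mem (by exact_mod_cast hn)]
    nlinarith [fejer_le_one (L / h * (Real.log n - y)), mul_nonneg ha hR]
  · rw [Set.indicator_of_notMem (by exact_mod_cast hn), zero_add]
    rcases eq_or_ne n 0 with rfl | hn0
    · simp
    refine mul_le_mul_of_nonneg_left ?_ ha
    have hu : h < |Real.log n - y| := by
      by_contra hcon
      exact hn (hs n hn0 (not_lt.1 hcon))
    have := fejer_mul_le L (v := h⁻¹ * (Real.log n - y)) (by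
      rw [abs_mul, abs_of_pos hh', inv_mul_eq_div, le_div_iff₀ hh]; linarith)
    rw [show L * (h⁻¹ * (Real.log n - y)) = L / h * (Real.log n - y) by ring,
      show h⁻¹ * (Real.log n - y) - Real.pi = h⁻¹ * (Real.log n - (y + Real.pi * h)) by
        field_simp; ring] at this
    rw [div_mul_eq_mul_div C, le_div_iff₀ (by positivity)]
    exact this

end WienerIkehara

section PrimeSums

open ArithmeticFunction ArithmeticFunction.vonMangoldt

lemma wienerIkehara_residueClass {q : ℕ} [NeZero q] {a : ZMod q} (ha : IsUnit a) :
    WienerIkehara (residueClass a) (q.totient : ℝ)⁻¹ (LFunctionResidueClassAux a) where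
  nonneg := residueClass_nonneg a
  zero := residueClass_apply_zero a
  summable s hs := LSeriesSummable_of_abscissaOfAbsConv_lt_re <|
    (abscissaOfAbsConv_residueClass_le_one a).trans_lt (by exact_mod_cast hs)
  cont := continuousOn_LFunctionResidueClassAux a
  eq := by simpa using eqOn_LFunctionResidueClassAux ha

lemma psi_sub_psi_le {h ε : ℝ} (hh : 0 < h) (hε : 0 < ε) :
    ∃ X₀ : ℝ, 1 ≤ X₀ ∧ ∀ x, X₀ ≤ x →
      Chebyshev.psi x - Chebyshev.psi (x * Real.exp (-h)) ≤ x * (h + ε) := by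
  have hW := wienerIkehara_residueClass (q := 1) (a := 1) isUnit_one
  obtain ⟨y₀, hy₀⟩ := eventually_atTop.1 (hW.eventually_sum_le hh hε)
  refine ⟨max 1 (Real.exp (y₀ + h)), le_max_left _ _, fun x hx => ?_⟩
  have hx1 : 1 ≤ x := (le_max_left _ _).trans hx
  have hx0 : 0 < x := by linarith
  have hlog : y₀ + h ≤ Real.log x := by
    rw [Real.le_log_iff_exp_le hx0]
    exact (le_max_right _ _).trans hx
  have hle : x * Real.exp (-h) ≤ x := mul_le_of_le_one_right hx0.le (Real.exp_le_one_iff.2 (by linarith))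
  have hf : ⌊x * Real.exp (-h)⌋₊ ≤ ⌊x⌋₊ := Nat.floor_mono hle
  have hdiff : Chebyshev.psi x - Chebyshev.psi (x * Real.exp (-h)) =
      ∑ n ∈ Finset.Ioc ⌊x * Real.exp (-h)⌋₊ ⌊x⌋₊, vonMangoldt n := by
    unfold Chebyshev.psi
    rw [sub_eq_iff_eq_add, add_comm, Finset.sum_Ioc_consecutive _ (Nat.zero_le _) hf]
  have hmem : ∀ n ∈ Finset.Ioc ⌊x * Real.exp (-h)⌋₊ ⌊x⌋₊, 0 < n ∧ x * Real.exp (-h) < n ∧ (n : ℝ) ≤ x := by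
    intro n hn
    rw [Finset.mem_Ioc] at hn
    exact ⟨by omega, (Nat.floor_lt (by positivity)).1 hn.1, (Nat.le_floor_iff hx0.le).1 hn.2⟩
  have key := hy₀ (Real.log x - h) (by linarith) (Finset.Ioc ⌊x * Real.exp (-h)⌋₊ ⌊x⌋₊) (fun n hn => by
    obtain ⟨h1, h2, h3⟩ := hmem n hn
    have hn0 : (0 : ℝ) < n := by exact_mod_cast h1
    refine ⟨?_, ?_⟩
    · have := Real.log_le_log (by positivity) h2.le
      rw [Real.log_mul hx0.ne' (Real.exp_pos _).ne', Real.log_exp] at this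
      linarith
    · have := Real.log_le_log hn0 h3
      linarith)
  rw [Nat.totient_one, Nat.cast_one, inv_one, one_mul] at key
  rw [hdiff]
  calc ∑ n ∈ Finset.Ioc ⌊x * Real.exp (-h)⌋₊ ⌊x⌋₊, vonMangoldt n
      ≤ ∑ n ∈ Finset.Ioc ⌊x * Real.exp (-h)⌋₊ ⌊x⌋₊, x * (residueClass (1 : ZMod 1) n / n) := by
        refine Finset.sum_le_sum fun n hn => ?_
        obtain ⟨h1, h2, h3⟩ := hmem n hn
        have hn0 : (0 : ℝ) < n := by exact_mod_cast h1
        have : residueClass (1 : ZMod 1) n = vonMangoldt n :=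
          Set.indicator_of_mem (show n ∈ {n : ℕ | (n : ZMod 1) = 1} from Subsingleton.elim _ _) _
        rw [this, ← mul_div_assoc, le_div_iff₀ hn0, mul_comm]
        exact mul_le_mul_of_nonneg_right h3 vonMangoldt_nonneg
    _ ≤ x * (h + ε) := by
        rw [← Finset.mul_sum]
        exact mul_le_mul_of_nonneg_left key hx0.le

/-- The upper bound in the prime number theorem. -/
lemma eventually_psi_le {δ : ℝ} (hδ : 0 < δ) :
    ∀ᶠ x : ℝ in atTop, Chebyshev.psi x ≤ (1 + δ) * x := by
  obtain ⟨h, hh, hhδ⟩ : ∃ h : ℝ, 0 < h ∧ (1 + h) ^ 2 < 1 + δ := by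
    have hc : Continuous fun h : ℝ => (1 + h) ^ 2 := by fun_prop
    have h2 := (hc.continuousAt.eventually_lt (x₀ := 0) continuousAt_const
      (show (1 + (0 : ℝ)) ^ 2 < 1 + δ by linarith)).filter_mono (nhdsWithin_le_nhds (s := Set.Ioi 0))
    obtain ⟨h, h3, h4⟩ := (h2.and self_mem_nhdsWithin).exists
    exact ⟨h, h4, h3⟩
  obtain ⟨X₀, hX₀, hX⟩ := psi_sub_psi_le hh (by positivity : 0 < h ^ 2)
  set C := Chebyshev.psi (X₀ * Real.exp h)
  have hC : 0 ≤ C := Chebyshev.psi_nonneg _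
  have hexp : Real.exp (-h) ≤ 1 / (1 + h) := by
    rw [Real.exp_neg, ← one_div]
    exact one_div_le_one_div_of_le (by positivity) (by linarith [Real.add_one_le_exp h])
  have hind : ∀ k : ℕ, ∀ x, 0 ≤ x → x ≤ X₀ * Real.exp h * Real.exp (k * h) →
      Chebyshev.psi x ≤ C + (1 + h) ^ 2 * x := by
    intro k
    induction k with
    | zero =>
      intro x hx0 hx
      rw [Nat.cast_zero, zero_mul, Real.exp_zero, mul_one] at hx
      have := Chebyshev.psi_mono hx
      have : 0 ≤ (1 + h) ^ 2 * x := by positivity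
      linarith
    | succ k ih =>
      intro x hx0 hx
      rcases le_total x X₀ with h1 | h1
      · have := Chebyshev.psi_mono (h1.trans (le_mul_of_one_le_right (by linarith)
          (Real.one_le_exp hh.le)))
        have : 0 ≤ (1 + h) ^ 2 * x := by positivity
        linarith
      · have h2 := hX x h1
        have h3 := ih (x * Real.exp (-h)) (by positivity) (by
          have := mul_le_mul_of_nonneg_right hx (Real.exp_pos (-h)).le
          refine this.trans_eq ?_
          rw [mul_assoc (X₀ * _), ← Real.exp_add]
          congr 2; push_cast; ring)
        have h4 : (1 + h) ^ 2 * (x * Real.exp (-h)) + x * (h + h ^ 2) ≤ (1 + h) ^ 2 * x := by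
          have : (1 + h) ^ 2 * (x * Real.exp (-h)) ≤ (1 + h) ^ 2 * (x * (1 / (1 + h))) := by gcongr
          have h5 : (1 + h) ^ 2 * (x * (1 / (1 + h))) = (1 + h) * x := by field_simp
          nlinarith
        linarith
  filter_upwards [eventually_ge_atTop (C / (1 + δ - (1 + h) ^ 2)), eventually_ge_atTop 0] with x hx hx0
  obtain ⟨k, hk⟩ : ∃ k : ℕ, x ≤ X₀ * Real.exp h * Real.exp (k * h) := by
    obtain ⟨k, hk⟩ := exists_nat_ge (x / h)
    refine ⟨k, ?_⟩
    rw [div_le_iff₀ hh] at hk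
    have h1 := Real.add_one_le_exp (k * h)
    have h2 := Real.one_le_exp hh.le
    have h3 : 1 ≤ X₀ * Real.exp h := by nlinarith
    nlinarith [Real.exp_pos (k * h)]
  have h1 := hind k x hx0 hk
  rw [div_le_iff₀ (by linarith)] at hx
  linarith

/-- Primes in a fixed unit residue class have positive proportion in `(d / (J + 1), d / J]`. -/
lemma exists_eventually_mul_le_sum_log_prime {q : ℕ} [NeZero q] {a : ZMod q} (ha : IsUnit a)
    {J : ℕ} (hJ : 1 ≤ J) :
    ∃ κ : ℝ, 0 < κ ∧ ∀ᶠ d : ℕ in atTop, κ * d ≤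
      ∑ p ∈ (Finset.Icc 1 d).filter (fun p : ℕ => p.Prime ∧ (p : ZMod q) = a ∧ J * p ≤ d ∧ d < (J + 1) * p),
        Real.log p := by
  have hW := wienerIkehara_residueClass ha
  have hJ0 : (0 : ℝ) < J := by exact_mod_cast hJ
  set g := (Real.log (J + 1) - Real.log J) with hg
  have hgpos : 0 < g := sub_pos.2 (Real.log_lt_log hJ0 (by linarith))
  obtain ⟨κ, hκ, hev⟩ := hW.exists_eventually_le_sum
    (by have := Nat.totient_pos.2 (NeZero.pos q); positivity) (show 0 < g / 4 by positivity)
  obtain ⟨B, hB⟩ := Chebyshev.psi_sub_theta_le_mul_sqrt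
  have hlim : Tendsto (fun d : ℕ => Real.log d - (Real.log J + g / 2)) atTop atTop :=
    tendsto_atTop_add_const_right _ _ (Real.tendsto_log_atTop.comp tendsto_natCast_atTop_atTop)
  refine ⟨κ / (J + 1) / 2, by positivity, ?_⟩
  have hsq : ∀ᶠ d : ℕ in atTop, B * √d ≤ κ / (J + 1) / 2 * d := by
    have : Tendsto (fun d : ℕ => √(d : ℝ)) atTop atTop :=
      Real.tendsto_sqrt_atTop.comp tendsto_natCast_atTop_atTop
    filter_upwards [this.eventually_ge_atTop (B / (κ / (J + 1) / 2))] with d hd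
    rw [div_le_iff₀ (by positivity)] at hd
    calc B * √d ≤ (√d * (κ / (J + 1) / 2)) * √d := by gcongr
      _ = κ / (J + 1) / 2 * (√d * √d) := by ring
      _ = _ := by rw [Real.mul_self_sqrt (by positivity)]
  filter_upwards [hlim.eventually hev, hsq, eventually_ge_atTop 1] with d hd hsq hd1
  have hd0 : (0 : ℝ) < d := by exact_mod_cast hd1
  set s := (Finset.Icc 1 d).filter (fun n : ℕ => J * n ≤ d ∧ d < (J + 1) * n) with hs
  have h1 := hd s (fun n hn0 hn => by
    have hn0' : (0 : ℝ) < n := by exact_mod_cast Nat.pos_of_ne_zero hn0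
    rw [abs_le] at hn
    have e1 : J * n < d := by
      have : Real.log J + Real.log n < Real.log d := by linarith
      rw [← Real.log_mul hJ0.ne' hn0'.ne', Real.log_lt_log_iff (by positivity) hd0] at this
      exact_mod_cast this
    have e2 : d < (J + 1) * n := by
      have : Real.log d < Real.log (J + 1) + Real.log n := by linarith
      rw [← Real.log_mul (by positivity) hn0'.ne', Real.log_lt_log_iff hd0 (by positivity)] at this
      exact_mod_cast this
    rw [hs, Finset.mem_filter, Finset.mem_Icc]
    exact ⟨⟨Nat.pos_of_ne_zero hn0, by nlinarith⟩, e1.le, e2⟩)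
  have h2 : ∑ n ∈ s, residueClass a n / n ≤ (J + 1) / d * ∑ n ∈ s, residueClass a n := by
    rw [Finset.mul_sum]
    refine Finset.sum_le_sum fun n hn => ?_
    rw [hs, Finset.mem_filter, Finset.mem_Icc] at hn
    have hn0 : (0 : ℝ) < n := by exact_mod_cast hn.1.1
    have hn2 : (d : ℝ) < (J + 1) * n := by exact_mod_cast hn.2.2
    rw [div_mul_eq_mul_div, div_le_div_iff₀ hn0 hd0, mul_comm, mul_right_comm]
    exact mul_le_mul_of_nonneg_right hn2.le (residueClass_nonneg a n)
  have h3 : κ / (J + 1) * d ≤ ∑ n ∈ s, residueClass a n := by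
    have := h1.trans h2
    rw [div_mul_eq_mul_div, le_div_iff₀ hd0] at this
    rw [div_mul_eq_mul_div, div_le_iff₀ (by positivity)]
    linarith
  rw [← Finset.sum_filter_add_sum_filter_not s Nat.Prime] at h3
  have h4 : ∑ n ∈ s with ¬ n.Prime, residueClass a n ≤ B * √d := by
    refine le_trans ?_ (hB d)
    rw [Chebyshev.psi_sub_theta_eq_sum_not_prime, Nat.floor_natCast]
    refine (Finset.sum_le_sum fun n _ => residueClass_le a n).trans ?_
    refine Finset.sum_le_sum_of_subset_of_nonneg ?_ fun _ _ _ => vonMangoldt_nonneg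
    intro n hn
    simp only [hs, Finset.mem_filter, Finset.mem_Icc, Finset.mem_Ioc] at hn ⊢
    exact ⟨⟨hn.1.1.1, hn.1.1.2⟩, hn.2⟩
  have h5 : ∑ n ∈ s with n.Prime, residueClass a n = 
      ∑ p ∈ (Finset.Icc 1 d).filter (fun p : ℕ => p.Prime ∧ (p : ZMod q) = a ∧ J * p ≤ d ∧ d < (J + 1) * p),
        Real.log p := by
    simp only [residueClass, Set.indicator_apply, Set.mem_ofPred_eq]
    rw [← Finset.sum_filter]
    refine Finset.sum_congr ?_ ?_
    · ext n
      simp only [hs, Finset.mem_filter]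
      tauto
    · intro n hn
      exact vonMangoldt_apply_prime (Finset.mem_filter.1 hn).2.1
  rw [← h5]
  have : κ / (J + 1) / 2 * d + κ / (J + 1) / 2 * d = κ / (J + 1) * d := by ring
  linarith

end PrimeSums

end PrimesInProgressions

section Denominators

lemma Rat.den_dvd_of_mul_natCast_eq {x : ℚ} {n : ℕ} {z : ℤ} (h : x * n = z) : x.den ∣ n := by
  rcases Nat.eq_zero_or_pos n with rfl | hn
  · simp
  · have hx : x = Rat.divInt z n := by
      rw [Rat.divInt_eq_div, ← h]
      field_simp
      simp
    rw [hx]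
    exact_mod_cast Rat.den_dvd z n

lemma Rat.exists_mul_natCast_eq_of_den_dvd {x : ℚ} {n : ℕ} (h : x.den ∣ n) :
    ∃ z : ℤ, x * n = z := by
  obtain ⟨m, rfl⟩ := h
  refine ⟨x.num * m, ?_⟩
  push_cast
  rw [← mul_assoc, Rat.mul_den_eq_num]

lemma Rat.den_sum_dvd {ι : Type*} (s : Finset ι) (f : ι → ℚ) {n : ℕ}
    (h : ∀ i ∈ s, (f i).den ∣ n) : (∑ i ∈ s, f i).den ∣ n := by
  classical
  induction s using Finset.induction_on with
  | empty => simp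
  | insert a s ha ih =>
    rw [Finset.sum_insert ha]
    exact (Rat.add_den_dvd_lcm _ _).trans (Nat.lcm_dvd (h a (by simp))
      (ih fun i hi => h i (by simp [hi])))

lemma Rat.den_intCast_div_natCast_dvd (z : ℤ) {n : ℕ} (hn : n ≠ 0) : ((z : ℚ) / n).den ∣ n :=
  Rat.den_dvd_of_mul_natCast_eq (z := z) (by field_simp)

lemma Nat.Prime.pow_dvd_or_of_pow_dvd_lcm {p : ℕ} (hp : p.Prime) {k m n : ℕ}
    (hm : m ≠ 0) (hn : n ≠ 0) (h : p ^ k ∣ m.lcm n) : p ^ k ∣ m ∨ p ^ k ∣ n := by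
  have h2 := (hp.pow_dvd_iff_le_factorization (Nat.lcm_ne_zero hm hn)).1 h
  rw [Nat.factorization_lcm hm hn, Finsupp.sup_apply] at h2
  rw [hp.pow_dvd_iff_le_factorization hm, hp.pow_dvd_iff_le_factorization hn]
  exact le_max_iff.1 h2

lemma Rat.not_pow_dvd_den_add {p : ℕ} (hp : p.Prime) {k : ℕ} {x y : ℚ}
    (hx : ¬ p ^ k ∣ x.den) (hy : ¬ p ^ k ∣ y.den) : ¬ p ^ k ∣ (x + y).den := fun h =>
  (hp.pow_dvd_or_of_pow_dvd_lcm x.den_nz y.den_nz (h.trans (Rat.add_den_dvd_lcm x y))).elim hx hy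

lemma Rat.pow_dvd_den_add {p : ℕ} (hp : p.Prime) {k : ℕ} {x y : ℚ}
    (hx : ¬ p ^ k ∣ x.den) (hy : p ^ k ∣ y.den) : p ^ k ∣ (x + y).den := by
  by_contra h
  have := Rat.not_pow_dvd_den_add hp h (show ¬ p ^ k ∣ (-x).den by simpa using hx)
  rw [add_neg_cancel_comm] at this
  exact this hy

lemma Rat.not_pow_dvd_den_sum {p : ℕ} (hp : p.Prime) {k : ℕ} (hk : k ≠ 0) {ι : Type*}
    (s : Finset ι) (f : ι → ℚ) (h : ∀ i ∈ s, ¬ p ^ k ∣ (f i).den) :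
    ¬ p ^ k ∣ (∑ i ∈ s, f i).den := by
  classical
  induction s using Finset.induction_on with
  | empty => simpa using ⟨hp.one_lt.ne', hk⟩
  | insert a s ha ih =>
    rw [Finset.sum_insert ha]
    exact Rat.not_pow_dvd_den_add hp (h a (by simp)) (ih fun i hi => h i (by simp [hi]))

lemma Rat.pow_dvd_den_sum {p : ℕ} (hp : p.Prime) {k : ℕ} {ι : Type*} [DecidableEq ι]
    (s : Finset ι) (f : ι → ℚ) {j : ι} (hj : j ∈ s) (hd : p ^ k ∣ (f j).den) (hk : k ≠ 0)
    (h : ∀ i ∈ s, i ≠ j → ¬ p ^ k ∣ (f i).den) :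
    p ^ k ∣ (∑ i ∈ s, f i).den := by
  rw [← Finset.sum_erase_add _ _ hj]
  exact Rat.pow_dvd_den_add hp (Rat.not_pow_dvd_den_sum hp hk _ _ fun i hi =>
    h i (Finset.mem_of_mem_erase hi) (Finset.ne_of_mem_erase hi)) hd

/-- The sum `∑ r i / i` over `a ≤ i ≤ b`. -/
def fracSum (r : ℕ → ℤ) (a b : ℕ) : ℚ := ∑ i ∈ Finset.Icc a b, (r i : ℚ) / i

lemma fracSum_eq_pred_add (r : ℕ → ℤ) {a b : ℕ} (h : a < b) :
    fracSum r a b = fracSum r a (b - 1) + (r b : ℚ) / b := by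
  obtain ⟨c, rfl⟩ : ∃ c, b = c + 1 := ⟨b - 1, by omega⟩
  rw [fracSum, Finset.sum_Icc_succ_top (by omega)]
  rfl

lemma Lab_pos (r : ℕ → ℤ) {a : ℕ} (b : ℕ) (ha : 1 ≤ a) : 0 < Lab r a b := by
  refine Nat.pos_of_ne_zero fun h => ?_
  obtain ⟨i, hi, h0⟩ := Finset.lcm_eq_zero_iff.1 h
  simp at hi h0
  omega

lemma vab_eq_den (r : ℕ → ℤ) {a : ℕ} (b : ℕ) (ha : 1 ≤ a) :
    vab r a b = (fracSum r a b).den := by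
  have hL := Lab_pos r b ha
  have hX : fracSum r a b = Rat.divInt (Xab r a b) (Lab r a b) := by
    rw [Rat.divInt_eq_div, eq_div_iff (by exact_mod_cast hL.ne'), fracSum, Xab, Finset.sum_mul]
    rw [Int.cast_sum]
    refine Finset.sum_congr rfl fun i hi => ?_
    rw [Int.cast_mul, Int.cast_natCast]
    by_cases hr : r i = 0
    · simp [hr]
    · have hd : i ∣ Lab r a b := Finset.dvd_lcm (f := id) (by simp [hr] at hi ⊢; exact hi)
      have hi0 : (i : ℚ) ≠ 0 := by
        have := (Finset.mem_Icc.1 hi).1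
        exact_mod_cast (show i ≠ 0 by omega)
      obtain ⟨m, hm⟩ := hd
      rw [hm, Nat.mul_div_cancel_left _ (by have := (Finset.mem_Icc.1 hi).1; omega)]
      push_cast
      field_simp
  rw [hX, Rat.den_divInt, if_neg (by exact_mod_cast hL.ne'), vab, gab]
  simp [Int.gcd_comm]

end Denominators

section LowerBound

lemma exists_pow_dvd_of_pow_dvd_den_fracSum {r : ℕ → ℤ} {a b p k : ℕ} (ha : 1 ≤ a)
    (hp : p.Prime) (hk : k ≠ 0) (h : p ^ k ∣ (fracSum r a b).den) :
    ∃ i, a ≤ i ∧ i ≤ b ∧ p ^ k ∣ i := by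
  by_contra! hc
  refine Rat.not_pow_dvd_den_sum hp hk (Finset.Icc a b) (fun i => (r i : ℚ) / i)
    (fun i hi hd => ?_) h
  obtain ⟨h1, h2⟩ := Finset.mem_Icc.1 hi
  exact hc i h1 h2 (hd.trans (Rat.den_intCast_div_natCast_dvd _ (by omega)))

lemma gcd_den_fracSum_dvd_lcmUpto {r : ℕ → ℤ} {a b : ℕ} (ha : 1 ≤ a) (hab : a < b) :
    (fracSum r a (b - 1)).den.gcd b ∣ Nat.lcmUpto (b - a) := by
  rw [Nat.dvd_iff_prime_pow_dvd_dvd]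
  intro p k hp hpk
  rcases Nat.eq_zero_or_pos k with rfl | hk
  · simp
  obtain ⟨i, h1, h2, h3⟩ := exists_pow_dvd_of_pow_dvd_den_fracSum ha hp hk.ne'
    (hpk.trans (Nat.gcd_dvd_left _ _))
  have h4 : p ^ k ∣ b - i := Nat.dvd_sub (hpk.trans (Nat.gcd_dvd_right _ _)) h3
  have h5 := Nat.le_of_dvd (by omega) h4
  have h6 : p ^ k ∈ Finset.Icc 1 (b - a) := by
    have := Nat.pow_pos hp.pos (n := k)
    simp; omega
  exact Finset.dvd_lcm (f := id) h6

lemma den_fracSum_pred_le {r : ℕ → ℤ} {a b R : ℕ} (ha : 1 ≤ a) (hab : a < b)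
    (hR : (r b).natAbs ≤ R) (hb : R * Nat.lcmUpto (b - a) ^ 2 ≤ b) :
    (fracSum r a (b - 1)).den ≤ (fracSum r a b).den := by
  have hS := fracSum_eq_pred_add r hab
  by_cases hr : r b = 0
  · rw [hS, hr]; simp
  set D := Nat.lcmUpto (b - a)
  have hg := gcd_den_fracSum_dvd_lcmUpto (r := r) ha hab
  set v := (fracSum r a (b - 1)).den with hv
  set w := (fracSum r a b).den with hw
  set g := v.gcd b with hgdef
  have hv0 : 0 < v := Rat.den_pos _
  have hw0 : 0 < w := Rat.den_pos _
  have hD0 : 0 < D := Nat.lcmUpto_pos _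
  have hb0 : b ≠ 0 := by omega
  have hvw : v ∣ w * g := by
    have h1 : v ∣ w * b := by
      have : fracSum r a (b - 1) = fracSum r a b - (r b : ℚ) / b := by rw [hS]; ring
      rw [hv, this]
      exact (Rat.sub_den_dvd _ _).trans
        (Nat.mul_dvd_mul_left _ (Rat.den_intCast_div_natCast_dvd _ hb0))
    have h2 : v ∣ w * v := dvd_mul_left _ _
    rw [hgdef, ← Nat.gcd_mul_left]
    exact Nat.dvd_gcd h2 h1
  have hbw : b ∣ w * g * (r b).natAbs := by
    have h1 : ((r b : ℚ) / b).den ∣ w * g := by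
      have : (r b : ℚ) / b = fracSum r a b - fracSum r a (b - 1) := by rw [hS]; ring
      rw [this]
      exact (Rat.sub_den_dvd_lcm _ _).trans (Nat.lcm_dvd (dvd_mul_right _ _) hvw)
    obtain ⟨z, hz⟩ := Rat.exists_mul_natCast_eq_of_den_dvd h1
    have hz2 : (r b) * ((w * g : ℕ) : ℤ) = z * b := by
      have hb0' : (b : ℚ) ≠ 0 := by exact_mod_cast hb0
      have : (r b : ℚ) * ((w * g : ℕ) : ℚ) = z * b := by
        rw [← hz]; field_simp
      exact_mod_cast this
    have h3 : (b : ℤ) ∣ r b * ((w * g : ℕ) : ℤ) := ⟨z, by rw [hz2, mul_comm]⟩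
    have h4 := Int.natAbs_dvd_natAbs.2 h3
    rw [Int.natAbs_mul, Int.natAbs_natCast, Int.natAbs_natCast, mul_comm] at h4
    exact h4
  have hlcm : v.lcm b ∣ w * g * (r b).natAbs := Nat.lcm_dvd (hvw.trans (dvd_mul_right _ _)) hbw
  have hr0 : 0 < (r b).natAbs := Int.natAbs_pos.2 hr
  have hg0 : 0 < g := Nat.gcd_pos_of_pos_left _ hv0
  have hgD : g ≤ D := Nat.le_of_dvd hD0 hg
  have h5 : v * b ≤ w * b := calc
    v * b = g * v.lcm b := (Nat.gcd_mul_lcm v b).symm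
    _ ≤ g * (w * g * (r b).natAbs) := Nat.mul_le_mul_left _ (Nat.le_of_dvd (by positivity) hlcm)
    _ = w * ((r b).natAbs * g ^ 2) := by ring
    _ ≤ w * (R * D ^ 2) := by gcongr
    _ ≤ w * b := Nat.mul_le_mul_left _ hb
  exact Nat.le_of_mul_le_mul_right h5 (by omega)

end LowerBound

section Periodic

variable {t : ℕ} {r : ℕ → ℤ}

lemma periodic_eq_of_modEq (hper : ∀ i, 1 ≤ i → r (i + t) = r i) {i j : ℕ} (hi : 1 ≤ i)
    (hj : 1 ≤ j) (h : i ≡ j [MOD t]) : r i = r j := by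
  have key : ∀ i m, 1 ≤ i → r (i + t * m) = r i := by
    intro i m hi
    induction m with
    | zero => simp
    | succ m ih => rw [Nat.mul_succ, ← add_assoc, hper _ (by omega), ih]
  rcases le_total i j with hij | hij
  · obtain ⟨m, hm⟩ := (Nat.modEq_iff_dvd' hij).1 h
    rw [show j = i + t * m by omega, key i m hi]
  · obtain ⟨m, hm⟩ := (Nat.modEq_iff_dvd' hij).1 h.symm
    rw [show i = j + t * m by omega, key j m hj]

lemma exists_natAbs_le_of_periodic (ht : 1 ≤ t) (hper : ∀ i, 1 ≤ i → r (i + t) = r i) :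
    ∃ R : ℕ, 1 ≤ R ∧ ∀ i, 1 ≤ i → (r i).natAbs ≤ R := by
  refine ⟨1 + ∑ j ∈ Finset.Icc 1 t, (r j).natAbs, by omega, fun i hi => ?_⟩
  have hmem : (i + t - 1) % t + 1 ∈ Finset.Icc 1 t := by
    have := Nat.mod_lt (i + t - 1) ht
    simp; omega
  have hmod : i ≡ (i + t - 1) % t + 1 [MOD t] := by
    have h1 : (i + t - 1) % t + 1 ≡ (i + t - 1) + 1 [MOD t] := (Nat.mod_modEq _ _).add_right 1
    have h2 : (i + t - 1) + 1 = i + t := by omega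
    rw [h2] at h1
    refine (h1.trans ?_).symm
    simp [Nat.ModEq]
  rw [periodic_eq_of_modEq hper hi (by omega) hmod]
  have := Finset.single_le_sum (f := fun j => (r j).natAbs) (fun _ _ => Nat.zero_le _) hmem
  omega

lemma vab_pred_le_of_le_log (ht : 1 ≤ t) (hper : ∀ i, 1 ≤ i → r (i + t) = r i)
    {ε : ℝ} (hε : 0 < ε) :
    ∃ A : ℕ, ∀ a : ℕ, A ≤ a → ∀ b : ℕ, a < b →
      (b : ℝ) ≤ (a : ℝ) + (1 / 2 - ε) * Real.log a → vab r a (b - 1) ≤ vab r a b := by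
  obtain ⟨R, hR1, hR⟩ := exists_natAbs_le_of_periodic ht hper
  obtain ⟨X, hX⟩ := eventually_atTop.1 (eventually_psi_le hε)
  have hpsi : ∀ d : ℕ, Chebyshev.psi d ≤ (1 + ε) * d + Chebyshev.psi X := by
    intro d
    rcases le_total X d with h | h
    · have := hX d h
      have := Chebyshev.psi_nonneg X
      linarith
    · have := Chebyshev.psi_mono h
      have : 0 ≤ (1 + ε) * d := by positivity
      linarith
  have hlarge : ∀ᶠ a : ℕ in atTop,
      Real.log R + 2 * Chebyshev.psi X ≤ ε * Real.log a :=
    ((Real.tendsto_log_atTop.comp tendsto_natCast_atTop_atTop).const_mul_atTop hε).eventually_ge_atTop _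
  obtain ⟨A, hA⟩ := eventually_atTop.1 (hlarge.and (eventually_ge_atTop 1))
  refine ⟨A, fun a ha b hab hb => ?_⟩
  obtain ⟨h1, ha1⟩ := hA a ha
  rw [vab_eq_den r _ ha1, vab_eq_den r _ ha1]
  refine den_fracSum_pred_le ha1 hab (hR b (by omega)) ?_
  have hD : (0 : ℝ) < Nat.lcmUpto (b - a) := by exact_mod_cast Nat.lcmUpto_pos _
  have ha0 : (0 : ℝ) < a := by exact_mod_cast ha1
  have hR0 : (0 : ℝ) < R := by exact_mod_cast hR1
  have hlog : 0 ≤ Real.log a := Real.log_nonneg (by exact_mod_cast ha1)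
  have h2 : Real.log (R * (Nat.lcmUpto (b - a) : ℝ) ^ 2) ≤ Real.log a := by
    rw [Real.log_mul hR0.ne' (by positivity), Real.log_pow, ← Chebyshev.psi_eq_log_lcmUpto]
    have h3 := hpsi (b - a)
    rw [Nat.cast_sub hab.le] at h3 ⊢
    have h4 : (1 + ε) * ((b : ℝ) - a) ≤ (1 + ε) * ((1 / 2 - ε) * Real.log a) := by
      gcongr; linarith
    push_cast
    nlinarith [mul_nonneg (mul_nonneg hε.le hε.le) hlog]
  have h5 := (Real.log_le_log_iff (by positivity) ha0).1 h2
  have h6 : R * Nat.lcmUpto (b - a) ^ 2 ≤ a := by exact_mod_cast h5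
  omega

end Periodic

section Loss

lemma Rat.pow_dvd_den_div {p k f b : ℕ} {z : ℤ} (hp : p.Prime) (hb : b ≠ 0)
    (hpb : p ^ (k + f) ∣ b) (hz : ¬ (p : ℤ) ^ (f + 1) ∣ z) : p ^ k ∣ ((z : ℚ) / b).den := by
  have hz0 : z ≠ 0 := by rintro rfl; simp at hz
  obtain ⟨w, hw⟩ := Rat.exists_mul_natCast_eq_of_den_dvd (dvd_refl ((z : ℚ) / b).den)
  set D := ((z : ℚ) / b).den with hD
  have h1 : z * (D : ℤ) = w * b := by
    have hb' : (b : ℚ) ≠ 0 := by exact_mod_cast hb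
    have : (z : ℚ) * D = w * b := by rw [← hw]; field_simp
    exact_mod_cast this
  have h2 : p ^ (k + f) ∣ z.natAbs * D := by
    have h3 : b ∣ z.natAbs * D := by
      have := Int.natAbs_dvd_natAbs.2 (show (b : ℤ) ∣ z * (D : ℤ) from ⟨w, by rw [h1, mul_comm]⟩)
      simpa [Int.natAbs_mul] using this
    exact hpb.trans h3
  have h4 : ¬ p ^ (f + 1) ∣ z.natAbs := fun h => hz (by
    have := Int.natCast_dvd.2 h
    simpa using this)
  have hzn : z.natAbs ≠ 0 := Int.natAbs_ne_zero.2 hz0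
  have hDn : D ≠ 0 := Rat.den_nz _
  rw [hp.pow_dvd_iff_le_factorization (mul_ne_zero hzn hDn), Nat.factorization_mul hzn hDn,
    Finsupp.add_apply] at h2
  rw [hp.pow_dvd_iff_le_factorization hzn] at h4
  rw [hp.pow_dvd_iff_le_factorization hDn]
  omega

lemma den_fracSum_lt_of_pow_dvd {r : ℕ → ℤ} {a b g n q k : ℕ} (hab : a < b)
    (hb : b = g * n) (hn : n ∣ (fracSum r a (b - 1)).den) (hq : q.Prime) (hgq : g < q)
    (hw : ¬ q ^ k ∣ (fracSum r a b).den) (hv : q ^ k ∣ (fracSum r a (b - 1)).den) :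
    (fracSum r a b).den < (fracSum r a (b - 1)).den := by
  have hS := fracSum_eq_pred_add r hab
  have hb0 : b ≠ 0 := by omega
  have h1 : (fracSum r a b).den ∣ (fracSum r a (b - 1)).den * g := by
    rw [hS]
    refine (Rat.add_den_dvd_lcm _ _).trans (Nat.lcm_dvd (dvd_mul_right _ _) ?_)
    refine (Rat.den_intCast_div_natCast_dvd _ hb0).trans ?_
    have h := Nat.mul_dvd_mul_right hn g
    rwa [mul_comm n g, ← hb] at h
  obtain ⟨c, hc⟩ := h1
  have hg0 : 0 < g := Nat.pos_of_ne_zero (by rintro rfl; simp at hb; omega)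
  have hv0 : 0 < (fracSum r a (b - 1)).den := Rat.den_pos _
  have hc0 : 0 < c := Nat.pos_of_ne_zero (by rintro rfl; have := Nat.mul_pos hv0 hg0; omega)
  have hqc : q ∣ c := by
    by_contra hqc
    refine hw (Nat.Coprime.dvd_of_dvd_mul_right
      (Nat.Coprime.pow_left k ((Nat.Prime.coprime_iff_not_dvd hq).2 hqc)) ?_)
    rw [← hc]
    exact hv.trans (dvd_mul_right _ _)
  have h2 := Nat.le_of_dvd hc0 hqc
  by_contra! h3
  have h4 : (fracSum r a (b - 1)).den * g < (fracSum r a (b - 1)).den * c :=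
    Nat.mul_lt_mul_of_pos_left (by omega) hv0
  have h5 := Nat.mul_le_mul_right c h3
  omega

/-- The data producing, for every large exponent `k`, indices `b = q ^ k * y` at which adding
`r b / b` lowers the power of `q` in the denominator. -/
structure LossPattern (r : ℕ → ℤ) (q s j : ℕ) : Prop where
  prime : q.Prime
  pos : 1 ≤ j
  not_dvd : ¬ q ∣ j
  ne_zero : r (q ^ s * j) ≠ 0
  eq_zero : ∀ h, 1 ≤ h → h ≤ j → q ∣ h → r (q ^ s * h) = 0
  integral : ∃ x : ℚ, ¬ q ∣ x.den ∧ ∑ h ∈ Finset.Icc 1 j, (r (q ^ s * h) : ℚ) / h = q * x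

lemma sum_filter_dvd_Icc {M : Type*} [AddCommMonoid M] (f : ℕ → M) {a c z j : ℕ}
    (hc : 0 < c) (h1 : c * z < a) (h2 : a ≤ c * (z + 1)) :
    ∑ i ∈ (Finset.Icc a (c * (z + j))).filter (fun i => c ∣ i), f i =
      ∑ h ∈ Finset.Icc 1 j, f (c * (z + h)) := by
  symm
  refine Finset.sum_bij (fun h _ => c * (z + h)) (fun h hh => ?_) (fun h _ h' _ e => ?_)
    (fun i hi => ?_) (fun _ _ => rfl)
  · obtain ⟨h3, h4⟩ := Finset.mem_Icc.1 hh
    simp only [Finset.mem_filter, Finset.mem_Icc, dvd_mul_right, and_true]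
    exact ⟨h2.trans (by gcongr), by gcongr⟩
  · have := Nat.eq_of_mul_eq_mul_left hc e
    omega
  · simp only [Finset.mem_filter, Finset.mem_Icc] at hi
    obtain ⟨⟨h3, h4⟩, i', rfl⟩ := hi
    have h5 := Nat.le_of_mul_le_mul_left h4 hc
    have h6 := lt_of_mul_lt_mul_left (h1.trans_le h3) (Nat.zero_le c)
    refine ⟨i' - z, Finset.mem_Icc.2 ⟨by omega, by omega⟩, ?_⟩
    rw [Nat.add_sub_cancel' h6.le]

namespace LossPattern

variable {t : ℕ} {r : ℕ → ℤ} {q s j : ℕ}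

lemma apply_eq (P : LossPattern r q s j) (hper : ∀ i, 1 ≤ i → r (i + t) = r i)
    {k z h : ℕ} (hk : q ^ k ≡ q ^ s [MOD t]) (hz : t * q ∣ z) (hh : 1 ≤ h) :
    r (q ^ k * (z + h)) = r (q ^ s * h) := by
  have hq := P.prime.pos
  refine periodic_eq_of_modEq hper (Nat.mul_pos (Nat.pow_pos hq) (by omega))
    (Nat.mul_pos (Nat.pow_pos hq) hh) (hk.mul ?_)
  have : z ≡ 0 [MOD t] := (Nat.modEq_zero_iff_dvd).2 ((dvd_mul_right t q).trans hz)
  simpa using this.add_right h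

lemma not_pow_dvd_den (P : LossPattern r q s j) (hper : ∀ i, 1 ≤ i → r (i + t) = r i)
    {a k z : ℕ} (hk0 : k ≠ 0) (hk : q ^ k ≡ q ^ s [MOD t]) (hz : t * q ∣ z)
    (h1 : q ^ k * z < a) (h2 : a ≤ q ^ k * (z + 1)) :
    ¬ q ^ k ∣ (fracSum r a (q ^ k * (z + j))).den := by
  have hq := P.prime
  rw [fracSum, ← Finset.sum_filter_add_sum_filter_not _ (fun i => q ^ k ∣ i)]
  refine Rat.not_pow_dvd_den_add hq ?_ (Rat.not_pow_dvd_den_sum hq hk0 _ _ fun i hi hd => ?_)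
  swap
  · simp only [Finset.mem_filter, Finset.mem_Icc] at hi
    exact hi.2 (hd.trans (Rat.den_intCast_div_natCast_dvd _ (by omega)))
  rw [sum_filter_dvd_Icc _ (Nat.pow_pos hq.pos) h1 h2]
  obtain ⟨x, hx, hsum⟩ := P.integral
  obtain ⟨z', rfl⟩ := (dvd_mul_left q t).trans hz
  obtain ⟨k', rfl⟩ := Nat.exists_eq_succ_of_ne_zero hk0
  have hqQ : (q : ℚ) ≠ 0 := by exact_mod_cast hq.ne_zero
  set X : ℚ := x + ∑ h ∈ Finset.Icc 1 j, ((-(r (q ^ s * h) * z') : ℤ) : ℚ) / ((q * z' + h) * h : ℕ)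
    with hX
  have hXden : ¬ q ∣ X.den := by
    have := Rat.not_pow_dvd_den_add hq (k := 1) (x := x)
      (y := ∑ h ∈ Finset.Icc 1 j, ((-(r (q ^ s * h) * z') : ℤ) : ℚ) / ((q * z' + h) * h : ℕ))
      (by simpa using hx) (Rat.not_pow_dvd_den_sum hq one_ne_zero _ _ fun h hh hd => ?_)
    · rwa [pow_one] at this
    obtain ⟨h3, h4⟩ := Finset.mem_Icc.1 hh
    rw [pow_one] at hd
    by_cases hqh : q ∣ h
    · rw [P.eq_zero h h3 h4 hqh] at hd
      simp at hd
      exact hq.ne_one hd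
    · have h5 := hd.trans (Rat.den_intCast_div_natCast_dvd _ (by positivity))
      rcases hq.dvd_mul.1 h5 with h6 | h6
      · exact hqh ((Nat.dvd_add_right (dvd_mul_right q z')).1 h6)
      · exact hqh h6
  have hmain : ∑ h ∈ Finset.Icc 1 j, (r (q ^ (k' + 1) * (q * z' + h)) : ℚ) /
      ((q ^ (k' + 1) * (q * z' + h) : ℕ) : ℚ) = X / q ^ k' := by
    have h5 : ∑ h ∈ Finset.Icc 1 j, (r (q ^ (k' + 1) * (q * z' + h)) : ℚ) /
        ((q ^ (k' + 1) * (q * z' + h) : ℕ) : ℚ) = (∑ h ∈ Finset.Icc 1 j,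
        ((r (q ^ s * h) : ℚ) / h +
          q * (((-(r (q ^ s * h) * z') : ℤ) : ℚ) / ((q * z' + h) * h : ℕ)))) / q ^ (k' + 1) := by
      rw [Finset.sum_div]
      refine Finset.sum_congr rfl fun h hh => ?_
      have h3 := (Finset.mem_Icc.1 hh).1
      have h6 : (h : ℚ) ≠ 0 := by exact_mod_cast (show h ≠ 0 by omega)
      have h7 : (q : ℚ) * z' + h ≠ 0 := by exact_mod_cast (show q * z' + h ≠ 0 by omega)
      rw [P.apply_eq hper hk hz h3]
      push_cast
      field_simp
      ring
    rw [h5, Finset.sum_add_distrib, hsum, ← Finset.mul_sum, ← mul_add, ← hX, pow_succ]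
    field_simp
  rw [hmain]
  intro hd
  have h8 : (X / q ^ k').den ∣ X.den * q ^ k' :=
    Rat.den_dvd_of_mul_natCast_eq (z := X.num) (by
      push_cast
      rw [← Rat.mul_den_eq_num X]
      field_simp)
  have h9 := hd.trans h8
  rw [pow_succ, mul_comm] at h9
  exact hXden (Nat.dvd_of_mul_dvd_mul_right (Nat.pow_pos hq.pos) h9)

lemma pow_dvd_den_pred (P : LossPattern r q s j) (hper : ∀ i, 1 ≤ i → r (i + t) = r i)
    {R : ℕ} (hR : ∀ i, 1 ≤ i → (r i).natAbs ≤ R) (hRq : R < q)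
    {a k z : ℕ} (hk0 : k ≠ 0) (hk : q ^ k ≡ q ^ s [MOD t]) (hz : t * q ∣ z)
    (h1 : q ^ k * z < a) (h2 : a ≤ q ^ k * (z + 1)) (hab : a < q ^ k * (z + j)) :
    q ^ k ∣ (fracSum r a (q ^ k * (z + j) - 1)).den := by
  have hq := P.prime
  have hS := fracSum_eq_pred_add r hab
  have h3 := P.not_pow_dvd_den hper hk0 hk hz h1 h2
  have h4 : fracSum r a (q ^ k * (z + j) - 1) = fracSum r a (q ^ k * (z + j)) +
      ((-r (q ^ k * (z + j)) : ℤ) : ℚ) / ((q ^ k * (z + j) : ℕ) : ℚ) := by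
    rw [hS]; push_cast; ring
  rw [h4]
  refine Rat.pow_dvd_den_add hq h3 (Rat.pow_dvd_den_div (f := 0) hq (by omega) (by simp) ?_)
  rw [zero_add, pow_one, Int.dvd_neg, P.apply_eq hper hk hz P.pos]
  intro hd
  have h5 := Int.natAbs_dvd_natAbs.2 hd
  have h6 := Nat.le_of_dvd (Int.natAbs_pos.2 P.ne_zero) h5
  have h7 := hR (q ^ s * j) (Nat.mul_pos (Nat.pow_pos hq.pos) P.pos)
  simp at h6
  omega

lemma den_lt (P : LossPattern r q s j) (hper : ∀ i, 1 ≤ i → r (i + t) = r i)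
    {R : ℕ} (hR : ∀ i, 1 ≤ i → (r i).natAbs ≤ R) (hRq : R < q)
    {a k z g n : ℕ} (hk0 : k ≠ 0) (hk : q ^ k ≡ q ^ s [MOD t]) (hz : t * q ∣ z)
    (h1 : q ^ k * z < a) (h2 : a ≤ q ^ k * (z + 1)) (hab : a < q ^ k * (z + j))
    (hgq : g < q) (hgn : z + j = g * n) (hcop : Nat.Coprime q n)
    (hn : n ∣ (fracSum r a (q ^ k * (z + j) - 1)).den) :
    (fracSum r a (q ^ k * (z + j))).den < (fracSum r a (q ^ k * (z + j) - 1)).den := by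
  have hv := P.pow_dvd_den_pred hper hR hRq hk0 hk hz h1 h2 hab
  refine den_fracSum_lt_of_pow_dvd (g := g) (n := q ^ k * n) hab (by rw [hgn]; ring)
    (Nat.Coprime.mul_dvd_of_dvd_of_dvd (hcop.pow_left k) hv hn) P.prime hgq
    (P.not_pow_dvd_den hper hk0 hk hz h1 h2) hv

end LossPattern

end Loss

section PatternOfDvd

lemma Rat.exists_pow_mul_eq_mul {q s : ℕ} (hq : q.Prime) (hs : s ≠ 0) {x : ℚ}
    (hx : ¬ q ^ s ∣ x.den) : ∃ w : ℚ, ¬ q ∣ w.den ∧ (q : ℚ) ^ s * x = q * w := by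
  obtain ⟨s, rfl⟩ := Nat.exists_eq_succ_of_ne_zero hs
  refine ⟨(q : ℚ) ^ s * x, fun hd => hx ?_, by rw [pow_succ]; ring⟩
  obtain ⟨m, u, hu, hm⟩ := Nat.exists_eq_pow_mul_and_not_dvd x.den_nz q hq.ne_one
  by_cases hms : m ≤ s
  · refine absurd (hd.trans (Rat.den_dvd_of_mul_natCast_eq (n := u)
      (z := x.num * q ^ (s - m)) ?_)) hu
    have h1 : (q : ℚ) ^ s = q ^ (s - m) * q ^ m := by rw [← pow_add]; congr 1; omega
    have h2 : x * (q ^ m * u) = x.num := by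
      have := Rat.mul_den_eq_num x
      rw [hm] at this
      exact_mod_cast this
    push_cast
    rw [h1, ← h2]; ring
  · rw [hm]
    exact (pow_dvd_pow q (by omega)).trans (dvd_mul_right _ _)

variable {t : ℕ} {r : ℕ → ℤ}

lemma exists_le_apply_mul_ne_zero (ht : 1 ≤ t) (hper : ∀ i, 1 ≤ i → r (i + t) = r i)
    (hnz : ∃ i, 1 ≤ i ∧ r i ≠ 0) {n : ℕ} (hn : 1 ≤ n) (hcop : n.Coprime t) :
    ∃ i, 1 ≤ i ∧ i ≤ t ∧ r (n * i) ≠ 0 := by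
  obtain ⟨i₀, hi₀, hr⟩ := hnz
  have : NeZero t := ⟨by omega⟩
  obtain ⟨c, hc⟩ : ∃ c : ℕ, n * c ≡ i₀ [MOD t] := by
    refine ⟨((n : ZMod t)⁻¹ * i₀).val, ?_⟩
    rw [← ZMod.natCast_eq_natCast_iff]
    push_cast
    rw [ZMod.natCast_zmod_val, ← mul_assoc, ZMod.coe_mul_inv_eq_one n hcop, one_mul]
  have hlt := Nat.mod_lt c ht
  have key : ∀ i, 1 ≤ i → i ≡ c [MOD t] → r (n * i) ≠ 0 := fun i hi h => by
    rwa [periodic_eq_of_modEq hper (Nat.mul_pos hn hi) hi₀ ((h.mul_left n).trans hc)]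
  by_cases h0 : c % t = 0
  · exact ⟨t, ht, le_rfl, key t ht (by simp [Nat.ModEq, h0])⟩
  · exact ⟨c % t, by omega, hlt.le, key _ (by omega) (Nat.mod_modEq _ _)⟩

lemma exists_lossPattern_of_dvd (ht : 1 ≤ t) (hper : ∀ i, 1 ≤ i → r (i + t) = r i)
    (hnz : ∃ i, 1 ≤ i ∧ r i ≠ 0) {q y : ℕ} (hq : q.Prime) (htq : t < q)
    (hy : ∃ i, 1 ≤ i ∧ i ≤ y ∧ r i ≠ 0)
    (hx : ∃ x : ℚ, ¬ q ∣ x.den ∧ fracSum r 1 y = q * x) :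
    ∃ s j, LossPattern r q s j ∧ j < t * q := by
  have hq0 := hq.pos
  let A : ℕ → Prop := fun s => ∃ i, 1 ≤ i ∧ q ^ s * i ≤ y ∧ r (q ^ s * i) ≠ 0
  have hA : ∃ s, A s ∧ ¬ A (s + 1) := by
    by_contra! hc
    have hall : ∀ s, A s := fun s => by
      induction s with
      | zero => simpa [A] using hy
      | succ s ih => exact hc s ih
    obtain ⟨i, h1, h2, -⟩ := hall y
    have h3 : y < q ^ y := Nat.lt_pow_self hq.one_lt
    have h4 := Nat.mul_le_mul_left (q ^ y) h1
    omega
  obtain ⟨s, hs, hs1⟩ := hA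
  have hqs : 0 < q ^ s := Nat.pow_pos hq0
  obtain ⟨j, ⟨hj1, hj2, hj3⟩, hmax⟩ : ∃ j, (1 ≤ j ∧ q ^ s * j ≤ y ∧ r (q ^ s * j) ≠ 0) ∧
      ∀ i, j < i → q ^ s * i ≤ y → r (q ^ s * i) = 0 := by
    classical
    let F := (Finset.range (y + 1)).filter fun i => 1 ≤ i ∧ q ^ s * i ≤ y ∧ r (q ^ s * i) ≠ 0
    have hmem : ∀ i, (1 ≤ i ∧ q ^ s * i ≤ y ∧ r (q ^ s * i) ≠ 0) → i ∈ F := fun i hi => by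
      have := Nat.le_mul_of_pos_left i hqs
      simp only [F, Finset.mem_filter, Finset.mem_range]
      exact ⟨by omega, hi⟩
    have hF : F.Nonempty := hs.imp hmem
    refine ⟨F.max' hF, (Finset.mem_filter.1 (F.max'_mem hF)).2, fun i hi hiy => ?_⟩
    by_contra hr
    have := F.le_max' i (hmem i ⟨by omega, hiy, hr⟩)
    omega
  have hzero : ∀ h, 1 ≤ h → h ≤ j → q ∣ h → r (q ^ s * h) = 0 := by
    rintro h hh1 hhj ⟨h', rfl⟩
    by_contra hr
    refine hs1 ⟨h', Nat.pos_of_mul_pos_left hh1, ?_, ?_⟩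
    · rw [pow_succ, mul_assoc]
      exact (Nat.mul_le_mul_left _ hhj).trans hj2
    · rwa [pow_succ, mul_assoc]
  refine ⟨s, j, ⟨hq, hj1, fun hd => hj3 (hzero j hj1 le_rfl hd), hj3, hzero, ?_⟩, ?_⟩
  · obtain ⟨x, hx1, hx2⟩ := hx
    rw [fracSum, ← Finset.sum_filter_add_sum_filter_not _ (fun i => q ^ s ∣ i)] at hx2
    set O := ∑ i ∈ (Finset.Icc 1 y).filter (fun i => ¬ q ^ s ∣ i), (r i : ℚ) / i with hO
    have h1 : ∑ i ∈ (Finset.Icc 1 y).filter (fun i => q ^ s ∣ i), (r i : ℚ) / i =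
        (∑ h ∈ Finset.Icc 1 j, (r (q ^ s * h) : ℚ) / h) / q ^ s := by
      have h2 : ∑ i ∈ (Finset.Icc 1 y).filter (fun i => q ^ s ∣ i), (r i : ℚ) / i =
          ∑ i ∈ (Finset.Icc 1 (q ^ s * (0 + j))).filter (fun i => q ^ s ∣ i), (r i : ℚ) / i := by
        symm
        refine Finset.sum_subset (fun i hi => ?_) fun i hi hni => ?_
        · simp only [Finset.mem_filter, Finset.mem_Icc, zero_add] at hi ⊢
          exact ⟨⟨hi.1.1, hi.1.2.trans hj2⟩, hi.2⟩
        · simp only [Finset.mem_filter, Finset.mem_Icc, zero_add, not_and] at hi hni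
          obtain ⟨⟨h3, h4⟩, i', rfl⟩ := hi
          have h5 : j < i' := by
            by_contra h6
            exact hni ⟨h3, Nat.mul_le_mul_left _ (by omega)⟩ (dvd_mul_right _ _)
          rw [hmax i' h5 h4]
          simp
      rw [h2, sum_filter_dvd_Icc _ hqs (by simp) (by omega), Finset.sum_div]
      refine Finset.sum_congr rfl fun h hh => ?_
      rw [zero_add]
      push_cast
      field_simp
    have hqQ : (q : ℚ) ≠ 0 := by exact_mod_cast hq.ne_zero
    have h3 : ∑ h ∈ Finset.Icc 1 j, (r (q ^ s * h) : ℚ) / h = q ^ s * (q * x) - q ^ s * O := by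
      rw [← hx2, h1]; field_simp; ring
    rcases Nat.eq_zero_or_pos s with rfl | hs0
    · refine ⟨x, hx1, ?_⟩
      rw [h3]
      simp [hO]
    · obtain ⟨w, hw1, hw2⟩ := Rat.exists_pow_mul_eq_mul (s := s) (x := O) hq hs0.ne'
        (Rat.not_pow_dvd_den_sum hq hs0.ne' _ _ fun i hi hd => by
          simp only [Finset.mem_filter, Finset.mem_Icc] at hi
          exact hi.2 (hd.trans (Rat.den_intCast_div_natCast_dvd _ (by omega))))
      refine ⟨q ^ s * x + -w, ?_, by rw [h3, hw2]; ring⟩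
      have h4 : ¬ q ^ 1 ∣ ((q : ℚ) ^ s * x).den := fun hd => hx1 (by
        rw [pow_one] at hd
        refine hd.trans (Rat.den_dvd_of_mul_natCast_eq (z := q ^ s * x.num) ?_)
        push_cast
        rw [← Rat.mul_den_eq_num x]; ring)
      have := Rat.not_pow_dvd_den_add hq h4 (y := -w) (by simpa using hw1)
      rwa [pow_one] at this
  · by_contra! hge
    have hcop : (q ^ (s + 1)).Coprime t := Nat.Coprime.pow_left _
      ((Nat.Prime.coprime_iff_not_dvd hq).2 fun hd => by
        have := Nat.le_of_dvd ht hd; omega)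
    obtain ⟨i, hi1, hit, hi⟩ := exists_le_apply_mul_ne_zero ht hper hnz
      (Nat.pow_pos hq0 (n := s + 1)) hcop
    refine hs1 ⟨i, hi1, le_trans ?_ hj2, hi⟩
    rw [pow_succ, mul_assoc]
    refine Nat.mul_le_mul_left _ (le_trans ?_ hge)
    rw [mul_comm t]
    exact Nat.mul_le_mul_left _ hit

end PatternOfDvd

section Growth

lemma prime_dvd_den_fracSum {r : ℕ → ℤ} {a b p m : ℕ} (ha : 1 ≤ a) (hp : p.Prime)
    (h1 : a ≤ p * m) (h2 : p * m ≤ b) (hr : r (p * m) ≠ 0) (hrp : (r (p * m)).natAbs < p)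
    (huniq : ∀ m', a ≤ p * m' → p * m' ≤ b → m' ≠ m → r (p * m') = 0) :
    p ∣ (fracSum r a b).den := by
  have key : p ^ 1 ∣ (fracSum r a b).den := by
    refine Rat.pow_dvd_den_sum hp _ (fun i => (r i : ℚ) / i) (j := p * m)
      (Finset.mem_Icc.2 ⟨h1, h2⟩) ?_ one_ne_zero fun i hi hne hd => ?_
    · refine Rat.pow_dvd_den_div (f := 0) hp (by omega) (by simp) fun hd => ?_
      rw [zero_add, pow_one] at hd
      have h3 := Nat.le_of_dvd (Int.natAbs_pos.2 hr) (Int.natAbs_dvd_natAbs.2 hd)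
      simp at h3
      omega
    · rw [pow_one] at hd
      obtain ⟨h3, h4⟩ := Finset.mem_Icc.1 hi
      obtain ⟨m', rfl⟩ := hd.trans (Rat.den_intCast_div_natCast_dvd _ (by omega))
      rw [huniq m' h3 h4 (by rintro rfl; exact hne rfl)] at hd
      simp at hd
      exact hp.ne_one hd
  rwa [pow_one] at key

variable {t : ℕ} {r : ℕ → ℤ}

lemma exists_first_ne_zero (hnz : ∃ i, 1 ≤ i ∧ r i ≠ 0) :
    ∃ J, 1 ≤ J ∧ r J ≠ 0 ∧ ∀ i, 1 ≤ i → i < J → r i = 0 := by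
  classical
  refine ⟨Nat.find hnz, (Nat.find_spec hnz).1, (Nat.find_spec hnz).2, fun i hi hlt => ?_⟩
  by_contra h
  exact Nat.find_min hnz hlt ⟨hi, h⟩

lemma exists_exp_le_den_fracSum (ht : 1 ≤ t) (hper : ∀ i, 1 ≤ i → r (i + t) = r i)
    (hnz : ∃ i, 1 ≤ i ∧ r i ≠ 0) :
    ∃ κ : ℝ, 0 < κ ∧ ∀ᶠ y : ℕ in atTop, Real.exp (κ * y) ≤ (fracSum r 1 y).den := by
  have : NeZero t := ⟨by omega⟩
  obtain ⟨R, -, hR⟩ := exists_natAbs_le_of_periodic ht hper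
  obtain ⟨J, hJ1, hJr, hJmin⟩ := exists_first_ne_zero hnz
  obtain ⟨κ, hκ, hev⟩ := exists_eventually_mul_le_sum_log_prime (q := t) (a := 1) isUnit_one hJ1
  refine ⟨κ, hκ, ?_⟩
  filter_upwards [hev, eventually_ge_atTop ((J + 1) * R)] with y hy hyR
  set F := (Finset.Icc 1 y).filter
    (fun p : ℕ => p.Prime ∧ (p : ZMod t) = 1 ∧ J * p ≤ y ∧ y < (J + 1) * p)
  have hF : ∀ p ∈ F, p.Prime ∧ (p : ZMod t) = 1 ∧ J * p ≤ y ∧ y < (J + 1) * p := fun p hp =>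
    (Finset.mem_filter.1 hp).2
  have hdvd : ∏ p ∈ F, p ∣ (fracSum r 1 y).den := by
    refine Finset.prod_primes_dvd _ (fun p hp => (hF p hp).1.prime) fun p hp => ?_
    obtain ⟨hp1, hp2, hp3, hp4⟩ := hF p hp
    have hmod : ∀ i, 1 ≤ i → r (p * i) = r i := fun i hi => by
      refine periodic_eq_of_modEq hper (Nat.mul_pos hp1.pos hi) hi ?_
      rw [← ZMod.natCast_eq_natCast_iff]
      push_cast
      rw [hp2, one_mul]
    have hRp : R < p := lt_of_mul_lt_mul_left (hyR.trans_lt hp4) (Nat.zero_le _)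
    refine prime_dvd_den_fracSum (m := J) le_rfl hp1 (Nat.mul_pos hp1.pos hJ1)
      (by rwa [mul_comm]) (by rwa [hmod J hJ1]) ((hR _ (Nat.mul_pos hp1.pos hJ1)).trans_lt hRp)
      fun m h1 h2 h3 => ?_
    have hm1 : 1 ≤ m := Nat.pos_of_mul_pos_left h1
    have hm2 : m < J + 1 := by
      refine lt_of_mul_lt_mul_right (a := p) ?_ (Nat.zero_le _)
      rw [mul_comm m]
      omega
    rw [hmod m hm1]
    exact hJmin m hm1 (by omega)
  have hle := Nat.le_of_dvd (Rat.den_pos _) hdvd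
  have hlog : ∑ p ∈ F, Real.log p = Real.log ((∏ p ∈ F, p : ℕ) : ℝ) := by
    push_cast
    rw [Real.log_prod]
    intro p hp
    exact_mod_cast (hF p hp).1.ne_zero
  rw [hlog] at hy
  have hpos : (0 : ℝ) < ((∏ p ∈ F, p : ℕ) : ℝ) := by
    exact_mod_cast Finset.prod_pos fun p hp => (hF p hp).1.pos
  calc Real.exp (κ * y) ≤ ((∏ p ∈ F, p : ℕ) : ℝ) := (Real.le_log_iff_exp_le hpos).1 hy
    _ ≤ _ := by exact_mod_cast hle

lemma eventually_sum_div_add_ne_zero (r : ℕ → ℤ) {i m : ℕ} (hi : 1 ≤ i) (him : i ≤ m)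
    (hr : r i ≠ 0) :
    ∀ᶠ n : ℕ in atTop, ∑ h ∈ Finset.Icc 1 m, (r h : ℚ) / ((n + h : ℕ) : ℚ) ≠ 0 := by
  classical
  let P : Polynomial ℝ := ∑ h ∈ Finset.Icc 1 m, Polynomial.C (r h : ℝ) *
    ∏ h' ∈ (Finset.Icc 1 m).erase h, (Polynomial.X + Polynomial.C (h' : ℝ))
  have hP : P ≠ 0 := by
    intro h0
    have h1 : P.eval (-(i : ℝ)) = 0 := by rw [h0]; simp
    have hmem : i ∈ Finset.Icc 1 m := Finset.mem_Icc.2 ⟨hi, him⟩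
    simp only [P, Polynomial.eval_finsetSum, Polynomial.eval_mul, Polynomial.eval_C,
      Polynomial.eval_prod, Polynomial.eval_add, Polynomial.eval_X] at h1
    rw [Finset.sum_eq_single_of_mem i hmem] at h1
    · rcases mul_eq_zero.1 h1 with h2 | h2
      · exact hr (by exact_mod_cast h2)
      · obtain ⟨h', hh', h3⟩ := Finset.prod_eq_zero_iff.1 h2
        have h4 : (h' : ℝ) = i := by linarith
        exact (Finset.ne_of_mem_erase hh') (by exact_mod_cast h4)
    · intro h hh hne
      rw [Finset.prod_eq_zero (Finset.mem_erase.2 ⟨hne.symm, hmem⟩) (by simp), mul_zero]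
  have hroots := tendsto_natCast_atTop_atTop.eventually (Polynomial.eventually_atTop_not_isRoot P hP)
  filter_upwards [hroots] with n hn h0
  apply hn
  have h1 : ∑ h ∈ Finset.Icc 1 m, (r h : ℝ) / ((n : ℝ) + h) = 0 := by
    have := congrArg (fun x : ℚ => (x : ℝ)) h0
    push_cast at this
    exact this
  simp only [Polynomial.IsRoot, P, Polynomial.eval_finsetSum, Polynomial.eval_mul,
    Polynomial.eval_C, Polynomial.eval_prod, Polynomial.eval_add, Polynomial.eval_X]
  have h2 : ∀ h ∈ Finset.Icc 1 m, (r h : ℝ) * ∏ h' ∈ (Finset.Icc 1 m).erase h, ((n : ℝ) + h') =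
      (r h : ℝ) / ((n : ℝ) + h) * ∏ h' ∈ Finset.Icc 1 m, ((n : ℝ) + h') := fun h hh => by
    have h3 : (n : ℝ) + h ≠ 0 := by
      have := (Finset.mem_Icc.1 hh).1
      positivity
    rw [← Finset.mul_prod_erase _ _ hh]
    field_simp
  rw [Finset.sum_congr rfl h2, ← Finset.sum_mul, h1, zero_mul]

lemma Nat.exists_prime_pow_dvd_of_smooth {C n : ℕ} {T : ℝ} (hT : 1 ≤ T)
    (hn : ∀ q, q.Prime → q ∣ n → q ≤ C) (hTn : T ^ C < n) :
    ∃ q e : ℕ, q.Prime ∧ q ≤ C ∧ T < (q : ℝ) ^ e ∧ q ^ e ∣ n := by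
  have hn0 : n ≠ 0 := by
    rintro rfl
    have : 0 ≤ T ^ C := by positivity
    simp at hTn
    linarith
  by_contra! hc
  have h1 : (n : ℝ) ≤ T ^ C := calc
    (n : ℝ) = ∏ q ∈ n.primeFactors, (q : ℝ) ^ n.factorization q := by
      conv_lhs => rw [← Nat.prod_factorization_pow_eq_self hn0]
      rw [Finsupp.prod, Nat.support_factorization]
      push_cast
      rfl
    _ ≤ ∏ q ∈ n.primeFactors, T := by
      refine Finset.prod_le_prod (fun _ _ => by positivity) fun q hq => ?_
      have hqp := Nat.prime_of_mem_primeFactors hq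
      by_contra! hlt
      exact hc q _ hqp (hn q hqp (Nat.dvd_of_mem_primeFactors hq)) hlt (Nat.ordProj_dvd n q)
    _ = T ^ n.primeFactors.card := by simp
    _ ≤ T ^ C := by
      refine pow_le_pow_right₀ hT ?_
      have : n.primeFactors ⊆ Finset.Icc 1 C := fun q hq => by
        have hqp := Nat.prime_of_mem_primeFactors hq
        exact Finset.mem_Icc.2 ⟨hqp.pos, hn q hqp (Nat.dvd_of_mem_primeFactors hq)⟩
      simpa using Finset.card_le_card this
  linarith

end Growth

section PatternExistence

variable {t : ℕ} {r : ℕ → ℤ}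

lemma fracSum_add_sub (hper : ∀ i, 1 ≤ i → r (i + t) = r i) {y : ℕ} (hy : t ∣ y) (m : ℕ) :
    fracSum r 1 (y + m) - fracSum r 1 y =
      ∑ h ∈ Finset.Icc 1 m, (r h : ℚ) / ((y + h : ℕ) : ℚ) := by
  induction m with
  | zero => simp
  | succ m ih =>
    have h1 : r (y + (m + 1)) = r (m + 1) := periodic_eq_of_modEq hper (by omega) (by omega) (by
      simpa using ((Nat.modEq_zero_iff_dvd).2 hy).add_right (m + 1))
    rw [Finset.sum_Icc_succ_top (by omega), ← ih]
    simp only [fracSum]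
    rw [← add_assoc y m 1, Finset.sum_Icc_succ_top (by omega), add_assoc y, h1]
    ring

lemma Rat.prime_pow_dvd_of_sub_mul_eq {q e₁ e₂ n : ℕ} (hq : q.Prime) {x y : ℚ} {z : ℤ}
    (hx : q ^ e₁ ∣ x.num.natAbs) (hy : q ^ e₂ ∣ y.num.natAbs) (he₁ : e₁ ≠ 0) (he₂ : e₂ ≠ 0)
    (hz : (x - y) * n = z) : q ^ min e₁ e₂ ∣ z.natAbs := by
  have hxd : ¬ q ∣ x.den := fun h => hq.one_lt.ne' (Nat.dvd_one.1
    (x.reduced ▸ Nat.dvd_gcd ((dvd_pow_self q he₁).trans hx) h))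
  have hyd : ¬ q ∣ y.den := fun h => hq.one_lt.ne' (Nat.dvd_one.1
    (y.reduced ▸ Nat.dvd_gcd ((dvd_pow_self q he₂).trans hy) h))
  have h1 : z * (x.den * y.den) = (x.num * y.den - y.num * x.den) * n := by
    have : (z : ℚ) * (x.den * y.den) = (x.num * y.den - y.num * x.den) * n := by
      rw [← hz, ← Rat.mul_den_eq_num x, ← Rat.mul_den_eq_num y]; ring
    exact_mod_cast this
  have hx' : ((q ^ min e₁ e₂ : ℕ) : ℤ) ∣ x.num :=
    Int.natCast_dvd.2 ((pow_dvd_pow q (min_le_left _ _)).trans hx)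
  have hy' : ((q ^ min e₁ e₂ : ℕ) : ℤ) ∣ y.num :=
    Int.natCast_dvd.2 ((pow_dvd_pow q (min_le_right _ _)).trans hy)
  have h2 : ((q ^ min e₁ e₂ : ℕ) : ℤ) ∣ z * (x.den * y.den) := by
    rw [h1]
    exact ((hx'.mul_right _).sub (hy'.mul_right _)).mul_right _
  have h3 := Int.natAbs_dvd_natAbs.2 h2
  rw [Int.natAbs_mul, Int.natAbs_natCast] at h3
  have h4 : ((x.den : ℤ) * (y.den : ℤ)).natAbs = x.den * y.den := by
    rw [Int.natAbs_mul, Int.natAbs_natCast, Int.natAbs_natCast]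
  rw [h4] at h3
  refine Nat.Coprime.dvd_of_dvd_mul_right (Nat.Coprime.pow_left _ ?_) h3
  exact ((Nat.Prime.coprime_iff_not_dvd hq).2 hxd).mul_right
    ((Nat.Prime.coprime_iff_not_dvd hq).2 hyd)

lemma eventually_mul_pow_lt_exp (K : ℝ) (A B G : ℕ) {c : ℝ} (hc : 0 < c) :
    ∀ᶠ M : ℕ in atTop, K * ((A * (M + B) : ℕ) : ℝ) ^ G < Real.exp (c * M) := by
  have h := ((isLittleO_pow_exp_pos_mul_atTop G hc).comp_tendsto
    tendsto_natCast_atTop_atTop).bound (c := (|K| * ((A : ℝ) * (1 + B)) ^ G + 1)⁻¹) (by positivity)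
  filter_upwards [h, eventually_ge_atTop 1] with M hM hM1
  simp only [Function.comp, norm_pow, RCLike.norm_natCast, Real.norm_eq_abs, Real.abs_exp] at hM
  have hM0 : (1 : ℝ) ≤ M := by exact_mod_cast hM1
  have h1 : ((A * (M + B) : ℕ) : ℝ) ≤ A * (1 + B) * M := by
    push_cast
    have : (0 : ℝ) ≤ A * B := by positivity
    nlinarith
  have hpos : (0 : ℝ) < |K| * ((A : ℝ) * (1 + B)) ^ G + 1 := by positivity
  rw [inv_mul_eq_div, le_div_iff₀ hpos] at hM
  have hMG : (0 : ℝ) < (M : ℝ) ^ G := by positivity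
  calc K * ((A * (M + B) : ℕ) : ℝ) ^ G ≤ |K| * (A * (1 + B) * M) ^ G := by
        gcongr; exact le_abs_self K
    _ = (|K| * ((A : ℝ) * (1 + B)) ^ G) * (M : ℝ) ^ G := by rw [mul_pow]; ring
    _ < (M : ℝ) ^ G * (|K| * ((A : ℝ) * (1 + B)) ^ G + 1) := by nlinarith
    _ ≤ _ := hM

lemma exists_large_prime_dvd_fracSum (ht : 1 ≤ t) (hper : ∀ i, 1 ≤ i → r (i + t) = r i)
    (hnz : ∃ i, 1 ≤ i ∧ r i ≠ 0) {C : ℕ} (hC : 1 ≤ C) :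
    ∃ q, q.Prime ∧ C < q ∧ ∃ y, (∃ i, 1 ≤ i ∧ i ≤ y ∧ r i ≠ 0) ∧
      ∃ x : ℚ, ¬ q ∣ x.den ∧ fracSum r 1 y = q * x := by
  by_contra! hc
  obtain ⟨R, hR1, hR⟩ := exists_natAbs_le_of_periodic ht hper
  obtain ⟨i₀, hi1, hit, hi⟩ := exists_le_apply_mul_ne_zero ht hper hnz le_rfl
    (Nat.coprime_one_left t)
  rw [one_mul] at hi
  have hsmooth : ∀ y, t ≤ y → ∀ q, q.Prime → q ∣ (fracSum r 1 y).num.natAbs → q ≤ C := by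
    intro y hy q hq hd
    by_contra! hCq
    obtain ⟨m, hm⟩ := Int.natCast_dvd.2 hd
    have hqd : ¬ q ∣ (fracSum r 1 y).den := fun h => hq.one_lt.ne' (Nat.dvd_one.1
      ((fracSum r 1 y).reduced ▸ Nat.dvd_gcd hd h))
    have hqQ : (q : ℚ) ≠ 0 := by exact_mod_cast hq.ne_zero
    refine hc q hq hCq y ⟨i₀, hi1, hit.trans hy, hi⟩ (fracSum r 1 y / q) (fun h => hqd ?_)
      (by field_simp)
    refine h.trans (Rat.den_dvd_of_mul_natCast_eq (z := m) ?_)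
    rw [div_mul_eq_mul_div, Rat.mul_den_eq_num, hm]
    push_cast
    field_simp
  obtain ⟨κ, hκ, hden⟩ := exists_exp_le_den_fracSum ht hper hnz
  set N := C + 2 with hN
  have hdiff : ∀ᶠ n : ℕ in atTop, ∀ m ∈ Finset.Icc 1 N,
      ∑ h ∈ Finset.Icc 1 (t * m), (r h : ℚ) / ((n + h : ℕ) : ℚ) ≠ 0 := by
    rw [Filter.eventually_all_finset]
    intro m hm
    exact eventually_sum_div_add_ne_zero r hi1
      (hit.trans (Nat.le_mul_of_pos_right t (Finset.mem_Icc.1 hm).1)) hi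
  obtain ⟨n₀, hn₀⟩ := eventually_atTop.1 (hden.and hdiff)
  have hC0 : (0 : ℝ) < C := by exact_mod_cast hC
  set G := t * N
  obtain ⟨M, hM, hMn⟩ := ((eventually_mul_pow_lt_exp (2 + R * G) t (2 * N) G
    (c := κ / (2 * C)) (by positivity)).and (eventually_ge_atTop (n₀ + 1))).exists
  set T := Real.exp (κ / (2 * C) * M) with hTdef
  set W := t * (M + 2 * N) with hW
  have hT1 : 1 ≤ T := Real.one_le_exp (by positivity)
  have hTC : T ^ C = Real.exp (κ / 2 * M) := by
    rw [hTdef, ← Real.exp_nat_mul]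
    congr 1
    field_simp
  have hMt : ∀ k, M ≤ t * (M + k) := fun k =>
    (Nat.le_add_right M k).trans (Nat.le_mul_of_pos_left _ ht)
  have hty : ∀ k, t ≤ t * (M + k) := fun k => Nat.le_mul_of_pos_right t (by omega)
  set H : ℕ → ℚ := fun k => fracSum r 1 (t * (M + k)) with hH
  have hlabel : ∀ k : ℕ, ∃ c ∈ Finset.range (C + 1),
      (|(H k : ℝ)| ≤ Real.exp (-(κ / 2 * M))) ∧ c = 0 ∨
      (c.Prime ∧ ∃ e, T < (c : ℝ) ^ e ∧ c ^ e ∣ (H k).num.natAbs) := by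
    intro k
    by_cases hsmall : |(H k : ℝ)| ≤ Real.exp (-(κ / 2 * M))
    · exact ⟨0, by simp, Or.inl ⟨hsmall, rfl⟩⟩
    · have h1 := (hn₀ (t * (M + k)) (by have := hMt k; omega)).1
      have h2 : T ^ C < ((H k).num.natAbs : ℕ) := by
        have h3 : (((H k).num.natAbs : ℕ) : ℝ) = |(H k : ℝ)| * (H k).den := by
          rw [Nat.cast_natAbs, Int.cast_abs, ← Nat.abs_cast (R := ℝ) (H k).den, ← abs_mul]
          congr 1
          exact_mod_cast (Rat.mul_den_eq_num (H k)).symm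
        rw [h3, hTC]
        push Not at hsmall
        have h4 : Real.exp (κ * M) ≤ (H k).den := by
          refine le_trans (Real.exp_le_exp.2 ?_) h1
          have : (M : ℝ) ≤ ((t * (M + k) : ℕ) : ℝ) := by exact_mod_cast hMt k
          gcongr
        calc Real.exp (κ / 2 * M) = Real.exp (-(κ / 2 * M)) * Real.exp (κ * M) := by
              rw [← Real.exp_add]; congr 1; ring
          _ < |(H k : ℝ)| * Real.exp (κ * M) := by gcongr
          _ ≤ _ := by gcongr
      obtain ⟨q, e, hq, hqC, hTe, hqe⟩ := Nat.exists_prime_pow_dvd_of_smooth hT1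
        (hsmooth _ (hty k)) h2
      exact ⟨q, by simp; omega, Or.inr ⟨hq, e, hTe, hqe⟩⟩
  choose c hcmem hc2 using hlabel
  have hpair : ∀ i j, i < j → j < N → c i ≠ c j := by
    intro i j hij hjN hcij
    set y := t * (M + i) with hy
    set m := j - i with hm
    have hm1 : m ∈ Finset.Icc 1 N := Finset.mem_Icc.2 ⟨by omega, by omega⟩
    have hyj : t * (M + j) = y + t * m := by
      rw [hy, ← mul_add]; congr 1; omega
    have hD : H j - H i = ∑ h ∈ Finset.Icc 1 (t * m), (r h : ℚ) / ((y + h : ℕ) : ℚ) := by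
      simp only [hH]
      rw [hyj]
      exact fracSum_add_sub hper (dvd_mul_right _ _) _
    have hD0 : H j - H i ≠ 0 := by
      rw [hD]
      exact (hn₀ y (by have := hMt i; omega)).2 m hm1
    have htm : t * m ≤ G := Nat.mul_le_mul_left _ (by omega)
    have hfac : ∀ h ∈ Finset.Icc 1 (t * m), y + h ≤ W := fun h hh => by
      have h1 := (Finset.mem_Icc.1 hh).2
      calc y + h ≤ y + t * m := by omega
        _ = t * (M + j) := hyj.symm
        _ ≤ W := Nat.mul_le_mul_left _ (by omega)
    have hW1 : 1 ≤ W := Nat.mul_pos ht (by omega)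
    have hprod : ∏ h ∈ Finset.Icc 1 (t * m), (y + h) ≤ W ^ G := calc
      _ ≤ ∏ h ∈ Finset.Icc 1 (t * m), W := Finset.prod_le_prod' hfac
      _ = W ^ (t * m) := by simp
      _ ≤ W ^ G := Nat.pow_le_pow_right hW1 htm
    obtain ⟨z, hz⟩ := Rat.exists_mul_natCast_eq_of_den_dvd
      (x := H j - H i) (n := ∏ h ∈ Finset.Icc 1 (t * m), (y + h)) (by
        rw [hD]
        refine Rat.den_sum_dvd _ _ fun h hh => ?_
        exact (Rat.den_intCast_div_natCast_dvd _ (by have := (Finset.mem_Icc.1 hh).1; omega)).trans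
          (Finset.dvd_prod_of_mem (fun h => y + h) hh))
    have hprod0 : 0 < ∏ h ∈ Finset.Icc 1 (t * m), (y + h) := Finset.prod_pos fun h hh => by
      have := (Finset.mem_Icc.1 hh).1; omega
    have hz0 : z ≠ 0 := by
      rintro rfl
      have : ((∏ h ∈ Finset.Icc 1 (t * m), (y + h) : ℕ) : ℚ) ≠ 0 := by exact_mod_cast hprod0.ne'
      exact (mul_ne_zero hD0 this) (by rw [hz]; simp)
    have hzabs : ((z.natAbs : ℕ) : ℝ) =
        |(H j : ℝ) - H i| * ((∏ h ∈ Finset.Icc 1 (t * m), (y + h) : ℕ) : ℝ) := by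
      rw [Nat.cast_natAbs, Int.cast_abs,
        ← Nat.abs_cast (R := ℝ) (∏ h ∈ Finset.Icc 1 (t * m), (y + h)), ← abs_mul]
      congr 1
      have := congrArg (fun x : ℚ => (x : ℝ)) hz
      push_cast at this ⊢
      exact this.symm
    have hprodR : ((∏ h ∈ Finset.Icc 1 (t * m), (y + h) : ℕ) : ℝ) ≤ (W : ℝ) ^ G := by
      exact_mod_cast hprod
    have hWG : (0 : ℝ) < (W : ℝ) ^ G := by positivity
    have hRG : (0 : ℝ) ≤ R * G := by positivity
    rcases hc2 i with ⟨hsi, hci⟩ | ⟨hpi, ei, hTi, hdi⟩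
    · rcases hc2 j with ⟨hsj, hcj⟩ | ⟨hpj, -⟩
      · have h1 : (1 : ℝ) ≤ z.natAbs := by exact_mod_cast Int.natAbs_pos.2 hz0
        have h2 : |(H j : ℝ) - H i| ≤ 2 * Real.exp (-(κ / 2 * M)) :=
          (abs_sub _ _).trans (by linarith)
        have h3 : (1 : ℝ) ≤ 2 * Real.exp (-(κ / 2 * M)) * (W : ℝ) ^ G := by
          rw [hzabs] at h1
          exact h1.trans (by gcongr)
        have h4 : Real.exp (κ / 2 * M) ≤ 2 * (W : ℝ) ^ G := by
          have := mul_le_mul_of_nonneg_left h3 (Real.exp_pos (κ / 2 * M)).le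
          have h5 : Real.exp (κ / 2 * M) * (2 * Real.exp (-(κ / 2 * M)) * (W : ℝ) ^ G) =
            2 * (W : ℝ) ^ G := by
            rw [Real.exp_neg]; field_simp
          linarith
        have h6 : T ≤ T ^ C := le_self_pow₀ hT1 (by omega)
        nlinarith
      · rw [← hcij, hci] at hpj
        exact Nat.not_prime_zero hpj
    · rcases hc2 j with ⟨-, hcj⟩ | ⟨hpj, ej, hTj, hdj⟩
      · rw [hcij, hcj] at hpi
        exact Nat.not_prime_zero hpi
      · rw [hcij] at hTi hdi
        have he : ∀ e, T < (c j : ℝ) ^ e → e ≠ 0 := by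
          rintro e h rfl
          simp at h
          linarith
        have h1 := Rat.prime_pow_dvd_of_sub_mul_eq hpj hdj hdi (he _ hTj) (he _ hTi) hz
        have h2 : T < (c j : ℝ) ^ min ej ei := by
          rcases min_choice ej ei with h | h <;> rw [h] <;> assumption
        have h3 : (c j : ℝ) ^ min ej ei ≤ z.natAbs := by
          exact_mod_cast Nat.le_of_dvd (Int.natAbs_pos.2 hz0) h1
        have h4 : |(H j : ℝ) - H i| ≤ R * G := by
          have h5 : |H j - H i| ≤ R * G := by
            rw [hD]
            refine (Finset.abs_sum_le_sum_abs _ _).trans ?_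
            have h6 : ∀ h ∈ Finset.Icc 1 (t * m), |(r h : ℚ) / ((y + h : ℕ) : ℚ)| ≤ R := by
              intro h hh
              have h7 := (Finset.mem_Icc.1 hh).1
              have h8 : |(r h : ℚ)| ≤ R := by
                rw [← Int.cast_abs, ← Nat.cast_natAbs]
                exact_mod_cast hR h h7
              rw [abs_div, Nat.abs_cast]
              refine (div_le_self (abs_nonneg _) ?_).trans h8
              exact_mod_cast (show 1 ≤ y + h by omega)
            refine (Finset.sum_le_card_nsmul _ _ _ h6).trans ?_
            rw [Nat.card_Icc, Nat.add_sub_cancel, nsmul_eq_mul, mul_comm]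
            have : ((t * m : ℕ) : ℚ) ≤ G := by exact_mod_cast htm
            gcongr
          have := (Rat.cast_le (K := ℝ)).2 h5
          push_cast at this
          exact this
        have h5 : ((z.natAbs : ℕ) : ℝ) ≤ R * G * (W : ℝ) ^ G := by
          rw [hzabs]; gcongr
        nlinarith
  obtain ⟨i, hiN, j, hjN, hne, heq⟩ := Finset.exists_ne_map_eq_of_card_lt_of_maps_to
    (s := Finset.range N) (t := Finset.range (C + 1)) (by simp; omega) (fun k _ => hcmem k)
  rw [Finset.mem_range] at hiN hjN
  rcases lt_or_gt_of_ne hne with h | h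
  · exact hpair i j h hjN heq
  · exact hpair j i h hiN heq.symm

lemma exists_lossPattern (ht : 1 ≤ t) (hper : ∀ i, 1 ≤ i → r (i + t) = r i)
    (hnz : ∃ i, 1 ≤ i ∧ r i ≠ 0) (C : ℕ) :
    ∃ q s j, LossPattern r q s j ∧ C < q ∧ t < q ∧ j < t * q := by
  obtain ⟨q, hq, hCq, y, hy, hx⟩ := exists_large_prime_dvd_fracSum ht hper hnz
    (C := C + t) (by omega)
  obtain ⟨s, j, P, hj⟩ := exists_lossPattern_of_dvd ht hper hnz hq (by omega) hy hx
  exact ⟨q, s, j, P, by omega, by omega, hj⟩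

end PatternExistence

section FrequentDrop

variable {t : ℕ} {r : ℕ → ℤ}

lemma Nat.pow_add_totient_mul_modEq {q t : ℕ} (h : q.Coprime t) (s m : ℕ) :
    q ^ (s + t.totient * m) ≡ q ^ s [MOD t] := by
  rw [pow_add, pow_mul]
  simpa using ((Nat.ModEq.pow_totient h).pow m).mul_left (q ^ s)

lemma prime_dvd_den_fracSum_sub (hper : ∀ i, 1 ≤ i → r (i + t) = r i) (ht : 1 ≤ t)
    {R : ℕ} (hR : ∀ i, 1 ≤ i → (r i).natAbs ≤ R) {p b d β c J : ℕ} (hp : p.Prime) (hRp : R < p)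
    (hpb : p ∣ b) (hβ : 1 ≤ β) (hbβ : b ≡ β [MOD t]) (hpc : p ≡ c [MOD t]) (hJ1 : 1 ≤ J)
    (hJ : r (β + (2 * t - 1) * c * J) ≠ 0)
    (hmin : ∀ i, 1 ≤ i → i < J → r (β + (2 * t - 1) * c * i) = 0)
    (h1 : J * p ≤ d) (h2 : d < (J + 1) * p) (hdb : d < b) :
    p ∣ (fracSum r (b - d) (b - 1)).den := by
  have hval : ∀ i, p * i < b → r (b - p * i) = r (β + (2 * t - 1) * c * i) := by
    intro i hi
    refine periodic_eq_of_modEq hper (by omega) (by omega) ?_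
    refine Nat.ModEq.add_right_cancel' (p * i) ?_
    rw [Nat.sub_add_cancel hi.le]
    have h3 : β + (2 * t - 1) * c * i + p * i ≡ β + (2 * t - 1) * c * i + c * i [MOD t] :=
      (hpc.mul_right i).add_left _
    have h4 : β + (2 * t - 1) * c * i + c * i = β + t * (2 * c * i) := by
      obtain ⟨u, hu⟩ : ∃ u, 2 * t = u + 1 := ⟨2 * t - 1, by omega⟩
      have : t * (2 * c * i) = (u + 1) * (c * i) := by rw [← hu]; ring
      rw [this, hu, Nat.add_sub_cancel]
      ring
    rw [h4] at h3
    refine hbβ.trans (h3.trans ?_).symm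
    simp [Nat.ModEq]
  obtain ⟨m, rfl⟩ := hpb
  have hJm : J < m := lt_of_mul_lt_mul_left (a := p) (by rw [mul_comm p J]; omega) (Nat.zero_le _)
  have hpm : ∀ i, p * (m - i) = p * m - p * i := fun i => Nat.mul_sub _ _ _
  have hJp : p * J < p * m := Nat.mul_lt_mul_of_pos_left hJm hp.pos
  have hJ1p : 1 ≤ p * J := Nat.mul_pos hp.pos hJ1
  have hcomm : p * J = J * p := mul_comm _ _
  refine prime_dvd_den_fracSum (m := m - J) (by omega) hp (by rw [hpm]; omega) (by rw [hpm]; omega)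
    (by rwa [hpm, hval J hJp]) ((hR _ (by rw [hpm]; omega)).trans_lt hRp) fun m' h3 h4 h5 => ?_
  have h6 : m' < m := lt_of_mul_lt_mul_left (a := p) (by omega) (Nat.zero_le _)
  have h7 : p * m' = p * m - p * (m - m') := by rw [← hpm, Nat.sub_sub_self h6.le]
  have h8 : p * (m - m') ≤ d := by
    have : p * (m - m') ≤ p * m := Nat.mul_le_mul_left _ (Nat.sub_le _ _)
    omega
  have h9 : m - m' < J + 1 := by
    refine lt_of_mul_lt_mul_right (a := p) ?_ (Nat.zero_le _)
    rw [mul_comm]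
    omega
  have h10 : p * (m - m') < p * m := by omega
  rw [h7, hval _ h10]
  exact hmin _ (by omega) (by omega)

lemma exists_first_apply_add_mul_ne_zero (ht : 1 ≤ t) (hper : ∀ i, 1 ≤ i → r (i + t) = r i)
    {β c : ℕ} (hβ : 1 ≤ β) (hrβ : r β ≠ 0) (hc : 1 ≤ c) (hct : c.Coprime t) :
    ∃ J, 1 ≤ J ∧ r (β + (2 * t - 1) * c * J) ≠ 0 ∧
      ∀ i, 1 ≤ i → i < J → r (β + (2 * t - 1) * c * i) = 0 := by
  have hcop : ((2 * t - 1) * c).Coprime t := by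
    refine Nat.Coprime.mul_left ?_ hct
    have : 2 * t - 1 = (t - 1) + t := by omega
    rw [this, Nat.coprime_add_self_left]
    have h2 : (t - 1).Coprime (t - 1 + 1) := by simp
    rwa [Nat.sub_add_cancel ht] at h2
  obtain ⟨i, hi, -, hr⟩ := exists_le_apply_mul_ne_zero (r := fun i => r (β + i)) ht
    (fun i hi => by rw [← add_assoc]; exact hper _ (by omega))
    ⟨t, ht, by rwa [hper β hβ]⟩ (n := (2 * t - 1) * c) (Nat.mul_pos (by omega) hc) hcop
  exact exists_first_ne_zero (r := fun i => r (β + (2 * t - 1) * c * i)) ⟨i, hi, hr⟩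

lemma LossPattern.exists_frequent_drop {q s j : ℕ} (P : LossPattern r q s j) (ht : 1 ≤ t)
    (hper : ∀ i, 1 ≤ i → r (i + t) = r i) {R : ℕ} (hR : ∀ i, 1 ≤ i → (r i).natAbs ≤ R)
    (hRq : R < q) (htq : t < q) :
    ∃ κ : ℝ, 0 < κ ∧ ∃ᶠ d : ℕ in atTop, ∃ b, d < b ∧ Real.exp (κ * d) ≤ b ∧
      (fracSum r (b - d) b).den < (fracSum r (b - d) (b - 1)).den := by
  have hq := P.prime
  have hq0 := hq.pos
  have hqt : q.Coprime t := (Nat.Prime.coprime_iff_not_dvd hq).2 fun hd => by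
    have := Nat.le_of_dvd ht hd; omega
  have : NeZero (t * q) := ⟨(Nat.mul_pos ht hq0).ne'⟩
  obtain ⟨g, hg, u, hu, hju⟩ := ZMod.eq_unit_mul_divisor (j : ZMod (t * q))
  have hgj : g ∣ j := by
    have h1 : (j : ZMod (t * q)) = ((u.val * g : ℕ) : ZMod (t * q)) := by
      push_cast; rw [ZMod.natCast_zmod_val, hju]
    rw [ZMod.natCast_eq_natCast_iff] at h1
    exact ((h1.of_dvd hg).trans
      ((Nat.modEq_zero_iff_dvd).2 (dvd_mul_left g _))).dvd_iff (dvd_refl g) |>.2 (dvd_zero g)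
  have hgq : g < q := by
    have h1 : g ∣ t := Nat.Coprime.dvd_of_dvd_mul_right
      ((Nat.Prime.coprime_iff_not_dvd hq).2 fun h => P.not_dvd (h.trans hgj)).symm hg
    exact (Nat.le_of_dvd ht h1).trans_lt htq
  set β := q ^ s * j with hβ
  have hβ1 : 1 ≤ β := Nat.mul_pos (Nat.pow_pos hq0) P.pos
  set c := u.val + t * q with hc
  have hcu : (c : ZMod (t * q)) = u := by simp [hc]
  have hct : c.Coprime t := by
    have h1 : IsUnit (c : ZMod (t * q)) := hcu ▸ hu
    exact ((ZMod.isUnit_iff_coprime c (t * q)).1 h1).coprime_mul_right_right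
  obtain ⟨J, hJ1, hJ, hJmin⟩ := exists_first_apply_add_mul_ne_zero ht hper hβ1 P.ne_zero
    le_rfl (Nat.coprime_one_left t)
  obtain ⟨J', hJ'1, hJ', hJ'min⟩ := exists_first_apply_add_mul_ne_zero ht hper hβ1 P.ne_zero
    (c := c) (by have := Nat.mul_pos ht hq0; omega) hct
  obtain ⟨κ, hκ, hev⟩ := exists_eventually_mul_le_sum_log_prime (q := t * q) (a := 1) isUnit_one hJ1
  obtain ⟨κ', hκ', hev'⟩ := exists_eventually_mul_le_sum_log_prime (q := t * q) (a := u) hu hJ'1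
  refine ⟨κ, hκ, ?_⟩
  obtain ⟨D, hD⟩ := eventually_atTop.1 ((hev.and hev').and
    (eventually_ge_atTop ((J + 1) * (R + q) + (J' + 1) * (R + q + j) + 1)))
  rw [frequently_atTop]
  intro A
  set k := s + t.totient * (A + D + 1) with hk
  have hkAD : A + D + 1 ≤ k := (Nat.le_mul_of_pos_left _ (Nat.totient_pos.2 ht)).trans
    (Nat.le_add_left _ _)
  have hkmod : q ^ k ≡ q ^ s [MOD t] := Nat.pow_add_totient_mul_modEq hqt s _
  have hkq : k < q ^ k := Nat.lt_pow_self hq.one_lt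
  have hjqk : q ^ k ≤ q ^ k * j := Nat.le_mul_of_pos_right _ P.pos
  set d := q ^ k * j - 1 with hd
  obtain ⟨⟨h1, h2⟩, h3⟩ := hD d (by omega)
  have hd0 : (0 : ℝ) < d := by exact_mod_cast (show 0 < d by omega)
  obtain ⟨p₁, hp₁⟩ : ((Finset.Icc 1 d).filter (fun p : ℕ => p.Prime ∧ (p : ZMod (t * q)) = u ∧
      J' * p ≤ d ∧ d < (J' + 1) * p)).Nonempty := by
    by_contra hne
    rw [Finset.not_nonempty_iff_eq_empty.1 hne, Finset.sum_empty] at h2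
    have := mul_pos hκ' hd0
    linarith
  obtain ⟨hp₁p, hp₁u, hp₁1, hp₁2⟩ := (Finset.mem_filter.1 hp₁).2
  have hp₁large : R + q + j < p₁ := by
    refine lt_of_mul_lt_mul_left (a := J' + 1) ?_ (Nat.zero_le _)
    omega
  set F := (Finset.Icc 1 d).filter (fun p : ℕ => p.Prime ∧ (p : ZMod (t * q)) = 1 ∧
      J * p ≤ d ∧ d < (J + 1) * p) with hF
  have hFmem : ∀ p ∈ F, p.Prime ∧ (p : ZMod (t * q)) = 1 ∧ J * p ≤ d ∧ d < (J + 1) * p :=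
    fun p hp => (Finset.mem_filter.1 hp).2
  have hFlarge : ∀ p ∈ F, R + q < p := fun p hp => by
    have := (hFmem p hp).2.2.2
    refine lt_of_mul_lt_mul_left (a := J + 1) ?_ (Nat.zero_le _)
    omega
  set n := ∏ p ∈ insert p₁ (F.erase p₁), p with hn
  have hn2 : n = p₁ * ∏ p ∈ F.erase p₁, p := Finset.prod_insert (Finset.notMem_erase _ _)
  have hprime : ∀ p ∈ insert p₁ (F.erase p₁), p.Prime ∧ R + q < p := fun p hp => by
    rcases Finset.mem_insert.1 hp with rfl | hp
    · exact ⟨hp₁p, by omega⟩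
    · exact ⟨(hFmem p (Finset.mem_of_mem_erase hp)).1, hFlarge p (Finset.mem_of_mem_erase hp)⟩
  have hn0 : 0 < n := Finset.prod_pos fun p hp => (hprime p hp).1.pos
  have hg0 : 0 < g := Nat.pos_of_dvd_of_pos hgj P.pos
  have hnmod : j ≡ g * n [MOD t * q] := by
    rw [← ZMod.natCast_eq_natCast_iff, hju, hn2]
    push_cast
    rw [Finset.prod_congr rfl fun p hp => (hFmem p (Finset.mem_of_mem_erase hp)).2.1, hp₁u]
    simp [mul_comm]
  have hp₁n : p₁ ≤ n := Nat.le_of_dvd hn0 (hn2 ▸ dvd_mul_right _ _)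
  have hjn : j ≤ g * n := by
    have : n ≤ g * n := Nat.le_mul_of_pos_left _ hg0
    omega
  obtain ⟨z, hz⟩ := (Nat.modEq_iff_dvd' hjn).1 hnmod
  have hzj : t * q * z + j = g * n := by omega
  set b := q ^ k * (t * q * z + j) with hb
  have hbd : b = q ^ k * (t * q * z) + (d + 1) := by
    rw [hb, mul_add]; omega
  have hbβ : b ≡ β [MOD t] := by
    refine hkmod.mul ?_
    simpa using ((Nat.modEq_zero_iff_dvd).2
      ((dvd_mul_right t q).trans (dvd_mul_right _ z))).add_right j
  have hbd' : b - d = q ^ k * (t * q * z) + 1 := by omega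
  have hnb : n ∣ b := by rw [hb, hzj]; exact (dvd_mul_left n g).trans (dvd_mul_left _ _)
  have hcast : ∀ p x : ℕ, (p : ZMod (t * q)) = x → p ≡ x [MOD t] := fun p x h =>
    ((ZMod.natCast_eq_natCast_iff p x _).1 h).of_dvd (dvd_mul_right t q)
  have hnv : n ∣ (fracSum r (b - d) (b - 1)).den := by
    refine Finset.prod_primes_dvd _ (fun p hp => (hprime p hp).1.prime) fun p hp => ?_
    have hpb : p ∣ b := (Finset.dvd_prod_of_mem _ hp).trans hnb
    obtain ⟨hpp, hRp⟩ := hprime p hp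
    rcases Finset.mem_insert.1 hp with rfl | hp
    · exact prime_dvd_den_fracSum_sub hper ht hR hpp (by omega) hpb hβ1 hbβ
        (hcast p c (by rw [hp₁u, hcu])) hJ'1 hJ' hJ'min hp₁1 hp₁2 (by omega)
    · obtain ⟨-, h4, h5, h6⟩ := hFmem p (Finset.mem_of_mem_erase hp)
      exact prime_dvd_den_fracSum_sub hper ht hR hpp (by omega) hpb hβ1 hbβ
        (hcast p 1 (by rw [h4, Nat.cast_one])) hJ1 hJ hJmin h5 h6 (by omega)
  refine ⟨d, by omega, b, by omega, ?_, ?_⟩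
  · have h4 : ∏ p ∈ F, p ≤ n := by
      refine Finset.prod_le_prod_of_subset_of_one_le' (fun p hp => ?_) fun p hp _ =>
        (hprime p hp).1.pos
      by_cases h : p = p₁
      · simp [h]
      · simp [h, hp]
    have h5 : n ≤ b := Nat.le_of_dvd (by omega) hnb
    have h6 : ∑ p ∈ F, Real.log p = Real.log ((∏ p ∈ F, p : ℕ) : ℝ) := by
      push_cast
      rw [Real.log_prod]
      intro p hp
      exact_mod_cast (hFmem p hp).1.ne_zero
    rw [h6, Real.le_log_iff_exp_le
      (by exact_mod_cast Finset.prod_pos fun p hp => (hFmem p hp).1.pos)] at h1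
    exact h1.trans (by exact_mod_cast h4.trans h5)
  · have hcop : Nat.Coprime q n := Nat.Coprime.prod_right fun p hp =>
      (Nat.coprime_primes hq (hprime p hp).1).2 (by have := (hprime p hp).2; omega)
    refine P.den_lt hper hR hRq (by omega) hkmod (dvd_mul_right _ z) (by omega) ?_ (by omega)
      hgq hzj hcop hnv
    rw [hbd', mul_add]
    have := Nat.pow_pos hq0 (n := k)
    omega

end FrequentDrop

section DiophantineApproximation

lemma exists_natCast_mul_sub_natCast_mul_mem_Ioo {x y c₁ c₂ : ℝ} (hx : 0 < x) (hy : 0 < y)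
    (h : Irrational (x / y)) (hc : c₁ < c₂) (N : ℕ) :
    ∃ M m : ℕ, N ≤ M ∧ N ≤ m ∧ (M * x - m * y : ℝ) ∈ Set.Ioo c₁ c₂ := by
  have : Fact (0 < y) := ⟨hy⟩
  obtain ⟨c, hc₁, hc₂⟩ := exists_between hc
  have hcl : MapClusterPt (c : AddCircle y) atTop (fun n : ℕ => n • (x : AddCircle y)) :=
    ((mapClusterPt_atTop_nsmul_tfae (c : AddCircle y) (x : AddCircle y)).out 0 3).2
      (AddCircle.denseRange_zsmul_coe_iff.2 h _)
  have hopen : IsOpen ((fun w : ℝ => (w : AddCircle y)) '' Set.Ioo c₁ c₂) :=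
    QuotientAddGroup.isOpenMap_coe _ isOpen_Ioo
  have hfr := hcl.frequently (hopen.mem_nhds ⟨c, ⟨hc₁, hc₂⟩, rfl⟩)
  obtain ⟨K, hK⟩ := exists_nat_ge ((N * y + c₂) / x)
  obtain ⟨M, hM, w, hw, hwM⟩ := frequently_atTop.1 hfr (max N K)
  have h1 : ((M * x - w : ℝ) : AddCircle y) = 0 := by
    rw [AddCircle.coe_sub, sub_eq_zero, ← nsmul_eq_mul, AddCircle.coe_nsmul]
    exact hwM.symm
  obtain ⟨k, hk⟩ := (AddCircle.coe_eq_zero_iff y).1 h1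
  rw [zsmul_eq_mul] at hk
  have h2 : (N : ℝ) < k := by
    have h3 : (K : ℝ) ≤ M := by exact_mod_cast (le_max_right _ _).trans hM
    have h4 : N * y + c₂ ≤ M * x := (div_le_iff₀ hx).1 (hK.trans h3)
    have h5 := hw.2
    exact lt_of_mul_lt_mul_right (a := y) (by linarith) hy.le
  have h6 : (N : ℤ) < k := by exact_mod_cast h2
  lift k to ℕ using by omega
  refine ⟨M, k, (le_max_left _ _).trans hM, by omega, ?_⟩
  rw [Int.cast_natCast] at hk
  rwa [hk, sub_sub_cancel]

lemma Nat.Prime.irrational_log_div_log {p q : ℕ} (hp : p.Prime) (hq : q.Prime) (hpq : p ≠ q) :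
    Irrational (Real.log q / Real.log p) := by
  have hp1 : 0 < Real.log p := Real.log_pos (by exact_mod_cast hp.one_lt)
  have hq1 : 0 < Real.log q := Real.log_pos (by exact_mod_cast hq.one_lt)
  rintro ⟨z, hz⟩
  have hz0 : 0 < z := by
    have : (0 : ℝ) < z := by rw [hz]; exact _root_.div_pos hq1 hp1
    exact_mod_cast this
  have hnum : 0 < z.num := Rat.num_pos.2 hz0
  obtain ⟨n, hn⟩ := Int.eq_ofNat_of_zero_le hnum.le
  have h1 : (z.den : ℝ) * Real.log q = n * Real.log p := by
    have h2 : (z : ℝ) * z.den = n := by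
      have := Rat.mul_den_eq_num z
      rw [hn] at this
      exact_mod_cast this
    rw [← h2, hz]
    field_simp
  rw [← Real.log_pow, ← Real.log_pow] at h1
  have h3 : (q : ℝ) ^ z.den = (p : ℝ) ^ n := Real.log_injOn_pos
    (Set.mem_Ioi.2 (pow_pos (by exact_mod_cast hq.pos) _))
    (Set.mem_Ioi.2 (pow_pos (by exact_mod_cast hp.pos) _)) h1
  have h4 : q ^ z.den = p ^ n := by exact_mod_cast h3
  have h5 : q ∣ p ^ n := h4 ▸ dvd_pow_self q z.den_nz
  exact hpq ((Nat.prime_dvd_prime_iff_eq hq hp).1 (hq.dvd_of_dvd_pow h5)).symm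

lemma Nat.Prime.exists_pow_mul_lt_pow_mul {p q c A A' B : ℕ} (hp : p.Prime) (hq : q.Prime)
    (hpq : p ≠ q) (hc : 0 < c) (hA : 0 < A) (hAA' : A < A') (hB : 0 < B) (N : ℕ) :
    ∃ M m : ℕ, N ≤ M ∧ N ≤ m ∧ p ^ (c * m) * A < q ^ (c * M) * B ∧
      q ^ (c * M) * B < p ^ (c * m) * A' := by
  have hp0 : (0 : ℝ) < p := by exact_mod_cast hp.pos
  have hq0 : (0 : ℝ) < q := by exact_mod_cast hq.pos
  have hp1 : 0 < Real.log p := Real.log_pos (by exact_mod_cast hp.one_lt)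
  have hq1 : 0 < Real.log q := Real.log_pos (by exact_mod_cast hq.one_lt)
  have hc' : (0 : ℝ) < c := by exact_mod_cast hc
  have hA' : (0 : ℝ) < A := by exact_mod_cast hA
  have hA'' : (0 : ℝ) < A' := by exact_mod_cast hA.trans hAA'
  have hB' : (0 : ℝ) < B := by exact_mod_cast hB
  obtain ⟨M, m, hM, hm, h1, h2⟩ := exists_natCast_mul_sub_natCast_mul_mem_Ioo
    (x := c * Real.log q) (y := c * Real.log p) (c₁ := Real.log A - Real.log B)
    (c₂ := Real.log A' - Real.log B) (mul_pos hc' hq1) (mul_pos hc' hp1)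
    (by rw [mul_div_mul_left _ _ hc'.ne']; exact hp.irrational_log_div_log hq hpq)
    (by have := Real.log_lt_log hA' (show (A : ℝ) < A' by exact_mod_cast hAA'); linarith) N
  have key : ∀ (x : ℝ) (n D : ℕ), 0 < x → (0 : ℝ) < D →
      Real.log (x ^ (c * n) * D) = n * (c * Real.log x) + Real.log D := fun x n D hx hD => by
    rw [Real.log_mul (pow_pos hx _).ne' hD.ne', Real.log_pow]
    push_cast
    ring
  refine ⟨M, m, hM, hm, ?_, ?_⟩
  · have h3 : (p : ℝ) ^ (c * m) * A < (q : ℝ) ^ (c * M) * B := by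
      rw [← Real.log_lt_log_iff (by positivity) (by positivity), key _ _ _ hp0 hA',
        key _ _ _ hq0 hB']
      linarith
    exact_mod_cast h3
  · have h3 : (q : ℝ) ^ (c * M) * B < (p : ℝ) ^ (c * m) * A' := by
      rw [← Real.log_lt_log_iff (by positivity) (by positivity), key _ _ _ hp0 hA'',
        key _ _ _ hq0 hB']
      linarith
    exact_mod_cast h3

end DiophantineApproximation

section ExistsDrop

lemma Nat.Prime.pow_add_totient_mul_modEq {p t e : ℕ} (hp : p.Prime) (ht : 1 ≤ t)
    (hte : t < p ^ e) (m : ℕ) : p ^ (e + t.totient * m) ≡ p ^ e [MOD t] := by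
  obtain ⟨f, u, hu, rfl⟩ := Nat.exists_eq_pow_mul_and_not_dvd (n := t) (by omega) p hp.ne_one
  have hcop : p.Coprime u := (Nat.Prime.coprime_iff_not_dvd hp).2 hu
  have hu0 : 0 < u := Nat.pos_of_ne_zero (by rintro rfl; simp at hu)
  have hfe : f < e := (Nat.pow_lt_pow_iff_right hp.one_lt).1
    ((Nat.le_mul_of_pos_right _ hu0).trans_lt hte)
  refine (Nat.modEq_and_modEq_iff_modEq_mul (hcop.pow_left f)).1 ⟨?_, ?_⟩
  · exact ((Nat.modEq_zero_iff_dvd).2 (pow_dvd_pow p (by omega))).trans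
      ((Nat.modEq_zero_iff_dvd).2 (pow_dvd_pow p hfe.le)).symm
  · rw [Nat.totient_mul (hcop.pow_left f), mul_comm (Nat.totient _), mul_assoc]
    exact Nat.pow_add_totient_mul_modEq hcop e _

variable {t : ℕ} {r : ℕ → ℤ}

lemma exists_pow_dvd_den_fracSum (ht : 1 ≤ t) (hper : ∀ i, 1 ≤ i → r (i + t) = r i)
    {p e i₀ : ℕ} (hp : p.Prime) (hte : t < p ^ e) (hi₀ : 1 ≤ i₀) (hr : r (p ^ e * i₀) ≠ 0) :
    ∃ I, 1 ≤ I ∧ ∀ m a b, 1 ≤ a → a ≤ p ^ (e + t.totient * m) * I →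
      p ^ (e + t.totient * m) * I ≤ b → b < p ^ (e + t.totient * m) * (I + 1) →
      p ^ (e + t.totient * m) ∣ (fracSum r a b).den := by
  have happly : ∀ m i, 1 ≤ i → r (p ^ (e + t.totient * m) * i) = r (p ^ e * i) := fun m i hi =>
    periodic_eq_of_modEq hper (Nat.mul_pos (Nat.pow_pos hp.pos) hi)
      (Nat.mul_pos (Nat.pow_pos hp.pos) hi) ((hp.pow_add_totient_mul_modEq ht hte m).mul_right i)
  have hex : ∃ i, 1 ≤ i ∧ ∃ f, p ^ f ∣ i ∧ ¬ (p : ℤ) ^ (f + 1) ∣ r (p ^ e * i) := by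
    set m := (r (p ^ e * i₀)).natAbs with hm
    refine ⟨p ^ (t.totient * m) * i₀, Nat.mul_pos (Nat.pow_pos hp.pos) hi₀, t.totient * m,
      dvd_mul_right _ _, fun hd => ?_⟩
    rw [← mul_assoc, ← pow_add, happly m i₀ hi₀] at hd
    have h1 := Nat.le_of_dvd (Int.natAbs_pos.2 hr) (Int.natAbs_dvd_natAbs.2 hd)
    rw [Int.natAbs_pow, Int.natAbs_natCast, ← hm] at h1
    have h2 : m ≤ t.totient * m := Nat.le_mul_of_pos_left _ (Nat.totient_pos.2 ht)
    have h3 : t.totient * m + 1 < p ^ (t.totient * m + 1) := Nat.lt_pow_self hp.one_lt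
    omega
  classical
  obtain ⟨hI, f, hf, hfr⟩ := Nat.find_spec hex
  have hmin : ∀ i, 1 ≤ i → i < Nat.find hex → ∀ f, p ^ f ∣ i → (p : ℤ) ^ (f + 1) ∣ r (p ^ e * i) :=
    fun i hi hlt f hfi => by
      by_contra h
      exact Nat.find_min hex hlt ⟨hi, f, hfi, h⟩
  set I := Nat.find hex
  refine ⟨I, hI, fun m a b ha h1 h2 h3 => ?_⟩
  have he0 : e ≠ 0 := by rintro rfl; simp at hte; omega
  set K := e + t.totient * m with hK
  have hpK : 0 < p ^ K := Nat.pow_pos hp.pos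
  refine Rat.pow_dvd_den_sum hp _ (fun i => (r i : ℚ) / i) (Finset.mem_Icc.2 ⟨h1, h2⟩) ?_
    (by omega) fun i hi hne hd => ?_
  · refine Rat.pow_dvd_den_div (f := f) hp (by omega) ?_ (by rwa [happly m I hI])
    rw [pow_add]
    exact Nat.mul_dvd_mul_left _ hf
  · obtain ⟨h4, h5⟩ := Finset.mem_Icc.1 hi
    obtain ⟨i', rfl⟩ := hd.trans (Rat.den_intCast_div_natCast_dvd (r i) (by omega))
    have hi'0 : i' ≠ 0 := by rintro rfl; omega
    have hi'I : i' < I + 1 := lt_of_mul_lt_mul_left (h5.trans_lt h3) (Nat.zero_le _)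
    have hi'ne : i' ≠ I := fun h => hne (by rw [h])
    obtain ⟨g, u, hu, hgu⟩ := Nat.exists_eq_pow_mul_and_not_dvd hi'0 p hp.ne_one
    obtain ⟨w, hw⟩ := hmin i' (by omega) (by omega) g (hgu ▸ dvd_mul_right _ _)
    rw [happly m i' (by omega)] at hd
    obtain ⟨K', hK'⟩ : ∃ K', K = K' + 1 := ⟨K - 1, by omega⟩
    have hpQ : (p : ℚ) ≠ 0 := by exact_mod_cast hp.ne_zero
    have huQ : (u : ℚ) ≠ 0 := by
      have : u ≠ 0 := by rintro rfl; simp at hu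
      exact_mod_cast this
    have h6 := hd.trans (Rat.den_dvd_of_mul_natCast_eq (n := p ^ K' * u) (z := w) (by
      rw [hw, hgu, hK']
      push_cast
      field_simp
      ring))
    rw [hK', pow_succ] at h6
    exact hu (Nat.dvd_of_mul_dvd_mul_left (Nat.pow_pos hp.pos) h6)

lemma exists_den_fracSum_lt (ht : 1 ≤ t) (hper : ∀ i, 1 ≤ i → r (i + t) = r i)
    (hnz : ∃ i, 1 ≤ i ∧ r i ≠ 0) {a : ℕ} (ha : 1 ≤ a) :
    ∃ b, a < b ∧ (fracSum r a b).den < (fracSum r a (b - 1)).den := by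
  obtain ⟨R, -, hR⟩ := exists_natAbs_le_of_periodic ht hper
  obtain ⟨q, s, j, P, hCq, htq, hjtq⟩ := exists_lossPattern ht hper hnz (R + Nat.lcmUpto t)
  have hq := P.prime
  have hφ := Nat.totient_pos.2 ht
  have hqt : q.Coprime t := (Nat.Prime.coprime_iff_not_dvd hq).2 fun hd => by
    have := Nat.le_of_dvd ht hd; omega
  have hlarge : ∀ M, a ≤ M → a < q ^ (s + t.totient * M) := fun M hM => by
    have h1 : M ≤ t.totient * M := Nat.le_mul_of_pos_left _ hφ
    have h2 : s + t.totient * M < q ^ (s + t.totient * M) := Nat.lt_pow_self hq.one_lt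
    omega
  have key : ∀ M g n, a ≤ M → g < q → j = g * n → Nat.Coprime q n →
      n ∣ (fracSum r a (q ^ (s + t.totient * M) * j - 1)).den →
      ∃ b, a < b ∧ (fracSum r a b).den < (fracSum r a (b - 1)).den := by
    intro M g n hM hg hgn hcop hn
    have h1 := hlarge M hM
    have h2 : M ≤ t.totient * M := Nat.le_mul_of_pos_left _ hφ
    have h3 : a < q ^ (s + t.totient * M) * j :=
      h1.trans_le (Nat.le_mul_of_pos_right _ P.pos)
    refine ⟨_, h3, ?_⟩
    have := P.den_lt hper hR (by omega) (a := a) (k := s + t.totient * M) (z := 0) (by omega)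
      (Nat.pow_add_totient_mul_modEq hqt s M) (dvd_zero _) (by rw [mul_zero]; omega)
      (by simpa using h1.le) (by simpa using h3) hg (by simpa using hgn) hcop (by simpa using hn)
    simpa using this
  rcases lt_or_ge j q with hjq | hjq
  · exact key a j 1 le_rfl hjq (by simp) (by simp) (one_dvd _)
  obtain ⟨p, e, hp, ⟨j', hj'⟩, hte⟩ : ∃ p e, p.Prime ∧ p ^ e ∣ j ∧ t < p ^ e := by
    by_contra! h
    have h1 : j ∣ Nat.lcmUpto t := (Nat.dvd_iff_prime_pow_dvd_dvd _ _).2 fun p k hp hk =>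
      Finset.dvd_lcm (f := id) (Finset.mem_Icc.2 ⟨Nat.pow_pos hp.pos, h p k hp hk⟩)
    have := Nat.le_of_dvd (Nat.lcmUpto_pos t) h1
    omega
  have hj'0 : 0 < j' := Nat.pos_of_ne_zero (by rintro rfl; have := P.pos; simp at hj'; omega)
  have he0 : e ≠ 0 := by rintro rfl; simp at hte; omega
  have hpq : p ≠ q := by
    rintro rfl
    exact P.not_dvd (hj' ▸ (dvd_pow_self p he0).trans (dvd_mul_right _ _))
  have hj'q : j' < q := by
    refine lt_of_mul_lt_mul_left (a := t) ?_ (Nat.zero_le _)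
    refine lt_of_le_of_lt ?_ hjtq
    rw [hj']
    exact Nat.mul_le_mul_right _ hte.le
  obtain ⟨I, hI, hdvd⟩ := exists_pow_dvd_den_fracSum ht hper hp hte (i₀ := q ^ s * j')
    (Nat.mul_pos (Nat.pow_pos hq.pos) hj'0) (by
      have := P.ne_zero
      rwa [hj', mul_left_comm] at this)
  have hpe : 0 < p ^ e := Nat.pow_pos hp.pos
  obtain ⟨M, m, hM, hm, h1, h2⟩ := hp.exists_pow_mul_lt_pow_mul hq hpq hφ
    (A := p ^ e * I) (A' := p ^ e * (I + 1)) (B := q ^ s * j) (Nat.mul_pos hpe hI)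
    (Nat.mul_lt_mul_of_pos_left (Nat.lt_succ_self I) hpe)
    (Nat.mul_pos (Nat.pow_pos hq.pos) P.pos) a
  have e1 : ∀ x, p ^ (t.totient * m) * (p ^ e * x) = p ^ (e + t.totient * m) * x := fun x => by
    rw [pow_add]; ring
  have e2 : q ^ (t.totient * M) * (q ^ s * j) = q ^ (s + t.totient * M) * j := by
    rw [pow_add]; ring
  rw [e1, e2] at h1 h2
  refine key M j' (p ^ e) hM hj'q (by rw [hj', mul_comm])
    (((Nat.coprime_primes hq hp).2 hpq.symm).pow_right e) ?_
  refine (pow_dvd_pow p (Nat.le_add_right e (t.totient * m))).trans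
    (hdvd m a _ ha ?_ (by omega) (by omega))
  have h3 : m ≤ t.totient * m := Nat.le_mul_of_pos_left _ hφ
  have h4 : e + t.totient * m < p ^ (e + t.totient * m) := Nat.lt_pow_self hp.one_lt
  have h5 := Nat.le_mul_of_pos_right (p ^ (e + t.totient * m)) hI
  omega

end ExistsDrop

section Liminf

variable {t : ℕ} {r : ℕ → ℤ}

lemma bfun_le_of_den_lt {a b : ℕ} (ha : 1 ≤ a) (hab : a < b)
    (h : (fracSum r a b).den < (fracSum r a (b - 1)).den) : bfun r a ≤ b :=
  Nat.sInf_le ⟨hab, by rwa [vab_eq_den r _ ha, vab_eq_den r _ ha]⟩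

lemma bfun_spec (ht : 1 ≤ t) (hper : ∀ i, 1 ≤ i → r (i + t) = r i)
    (hnz : ∃ i, 1 ≤ i ∧ r i ≠ 0) {a : ℕ} (ha : 1 ≤ a) :
    a < bfun r a ∧ vab r a (bfun r a) < vab r a (bfun r a - 1) := by
  obtain ⟨b, hab, hb⟩ := exists_den_fracSum_lt ht hper hnz ha
  exact Nat.sInf_mem (s := {b : ℕ | a < b ∧ vab r a b < vab r a (b - 1)})
    ⟨b, hab, by rwa [vab_eq_den r _ ha, vab_eq_den r _ ha]⟩

lemma exists_frequently_bfun_le (ht : 1 ≤ t) (hper : ∀ i, 1 ≤ i → r (i + t) = r i)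
    (hnz : ∃ i, 1 ≤ i ∧ r i ≠ 0) :
    ∃ C : ℝ, ∃ᶠ a : ℕ in atTop, ((bfun r a : ℝ) - a) / Real.log a ≤ C := by
  obtain ⟨R, -, hR⟩ := exists_natAbs_le_of_periodic ht hper
  obtain ⟨q, s, j, P, hCq, htq, -⟩ := exists_lossPattern ht hper hnz R
  obtain ⟨κ, hκ, hfr⟩ := P.exists_frequent_drop ht hper hR hCq htq
  refine ⟨2 / κ, frequently_atTop.2 fun N => ?_⟩
  have hexp : Tendsto (fun x : ℝ => Real.exp (κ * x) / (κ * x)) atTop atTop := by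
    have := (Real.tendsto_exp_div_pow_atTop 1).comp (tendsto_id.const_mul_atTop hκ)
    simpa [Function.comp_def] using this
  have hlarge : ∀ᶠ d : ℕ in atTop, (2 * N + 4 : ℝ) ≤ κ * d ∧
      2 / κ ≤ Real.exp (κ * d) / (κ * d) ∧ 1 ≤ d :=
    ((tendsto_natCast_atTop_atTop.const_mul_atTop hκ).eventually_ge_atTop _).and
      (((hexp.comp tendsto_natCast_atTop_atTop).eventually_ge_atTop _).and
        (eventually_ge_atTop 1))
  obtain ⟨d, ⟨b, hdb, hb, hlt⟩, hd1, hd2, hd3⟩ := (hfr.and_eventually hlarge).exists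
  have hd0 : (0 : ℝ) < d := by exact_mod_cast hd3
  have hκd : 0 < κ * d := mul_pos hκ hd0
  have h1 : 2 * (d : ℝ) ≤ b := by
    rw [div_le_div_iff₀ hκ hκd] at hd2
    have : 2 * (d : ℝ) ≤ Real.exp (κ * d) := le_of_mul_le_mul_right (by linarith) hκ
    linarith
  have hcast : ((b - d : ℕ) : ℝ) = b - d := Nat.cast_sub hdb.le
  have h2 : Real.exp (κ * d) / 2 ≤ ((b - d : ℕ) : ℝ) := by rw [hcast]; linarith
  have h3 : Real.exp (κ * d / 2) ≤ Real.exp (κ * d) / 2 := by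
    have h4 : Real.exp (κ * d) = Real.exp (κ * d / 2) * Real.exp (κ * d / 2) := by
      rw [← Real.exp_add]; congr 1; ring
    have h5 := Real.add_one_le_exp (κ * d / 2)
    have hN : (0 : ℝ) ≤ N := Nat.cast_nonneg N
    rw [h4]
    nlinarith [Real.exp_pos (κ * d / 2)]
  have hN : (N : ℝ) ≤ ((b - d : ℕ) : ℝ) := by
    have h5 := Real.add_one_le_exp (κ * d / 2)
    linarith
  have hlog : κ * d / 2 ≤ Real.log ((b - d : ℕ) : ℝ) := by
    rw [Real.le_log_iff_exp_le ((Real.exp_pos _).trans_le (h3.trans h2))]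
    exact h3.trans h2
  refine ⟨b - d, by exact_mod_cast hN, ?_⟩
  have h6 : (bfun r (b - d) : ℝ) ≤ b := by
    exact_mod_cast bfun_le_of_den_lt (by omega) (by omega) hlt
  rw [div_le_iff₀ (by linarith [half_pos hκd])]
  calc (bfun r (b - d) : ℝ) - ((b - d : ℕ) : ℝ) ≤ d := by rw [hcast]; linarith
    _ = 2 / κ * (κ * d / 2) := by field_simp
    _ ≤ _ := mul_le_mul_of_nonneg_left hlog (by positivity)

lemma eventually_sub_le_bfun_ratio (ht : 1 ≤ t) (hper : ∀ i, 1 ≤ i → r (i + t) = r i)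
    (hnz : ∃ i, 1 ≤ i ∧ r i ≠ 0) {ε : ℝ} (hε : 0 < ε) :
    ∀ᶠ a : ℕ in atTop, 1 / 2 - ε ≤ ((bfun r a : ℝ) - a) / Real.log a := by
  obtain ⟨A, hA⟩ := vab_pred_le_of_le_log ht hper hε
  filter_upwards [eventually_ge_atTop A, eventually_ge_atTop 2] with a haA ha2
  obtain ⟨h1, h2⟩ := bfun_spec ht hper hnz (a := a) (by omega)
  have hlog : 0 < Real.log a := Real.log_pos (by exact_mod_cast ha2)
  rw [le_div_iff₀ hlog]
  by_contra! h3
  exact absurd (hA a haA _ h1 (by linarith)) (not_le.2 h2)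

lemma half_le_liminf_bfun_ratio (ht : 1 ≤ t) (hper : ∀ i, 1 ≤ i → r (i + t) = r i)
    (hnz : ∃ i, 1 ≤ i ∧ r i ≠ 0) :
    (1 : ℝ) / 2 ≤ atTop.liminf (fun a : ℕ => ((bfun r a : ℝ) - a) / Real.log a) := by
  obtain ⟨C, hC⟩ := exists_frequently_bfun_le ht hper hnz
  refine le_of_forall_pos_sub_le fun ε hε => ?_
  exact le_liminf_of_le (Filter.IsCoboundedUnder.of_frequently_le hC)
    (eventually_sub_le_bfun_ratio ht hper hnz hε)

end Liminf

/-- For every `0 < ε < 1/2` there is `A` such that for all `a ≥ A` and all `b` with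
`a < b ≤ a + (1/2 − ε)·log a`, one has `v_{a,b} ≥ v_{a,b-1}`; equivalently,
`liminf_{a→∞} (b(a) − a)/log a ≥ 1/2`. -/
theorem liminf_denominator_drop_ge_half
    (t : ℕ) (r : ℕ → ℤ) (ht : 1 ≤ t)
    (hper : ∀ i, 1 ≤ i → r (i + t) = r i)
    (hnz : ∃ i, 1 ≤ i ∧ r i ≠ 0) :
    (∀ ε : ℝ, 0 < ε → ε < 1 / 2 →
      ∃ A : ℕ, ∀ a : ℕ, A ≤ a → ∀ b : ℕ, a < b →
        (b : ℝ) ≤ (a : ℝ) + (1 / 2 - ε) * Real.log a →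
        vab r a (b - 1) ≤ vab r a b) ∧
    (1 : ℝ) / 2 ≤ atTop.liminf (fun a : ℕ => ((bfun r a : ℝ) - a) / Real.log a) := by
  exact ⟨fun _ hε _ => vab_pred_le_of_le_log ht hper hε,
    half_le_liminf_bfun_ratio ht hper hnz⟩
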